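/- arXiv:cs/0512025 — 6 statements merged into one kernel-verified Lean document; each statement's English description precedes it below -/
import Mathlib

section
/- Let C be a nonempty finite set, let τ0 ∈ ℝ, and let T : C × C → ℝ be a symmetric function with T(x,x) = τ0 for all x ∈ C. Let p_0, p_1, …, p_m : ℝ → ℝ be polynomials with p_0 ≡ 1 such that for every i ∈ {0,…,m} the Delsarte inequality ∑_{x∈C} ∑_{y∈C} p_i(T(x,y)) ≥ 0 holds. Let F = ∑_{i=0}^m F_i p_i be a polynomial with F_0 > 0 and F_i ≥ 0 for i = 1,…,m, and suppose that F(T(x,y)) ≤ 0 for all x, y ∈ C with x ≠ y. Then |C| ≤ F(τ0)/F_0. -/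
/-- Delsarte's linear programming bound (Theorem 1), stated abstractly. -/
theorem delsarte_lp_bound {C : Type*} [Fintype C] [Nonempty C]
    (τ0 : ℝ) (T : C → C → ℝ)
    (hsym : ∀ x y, T x y = T y x) (hdiag : ∀ x, T x x = τ0)
    (m : ℕ) (p : ℕ → Polynomial ℝ) (hp0 : p 0 = 1)
    (hdelsarte : ∀ i ≤ m, 0 ≤ ∑ x : C, ∑ y : C, (p i).eval (T x y))
    (F : ℕ → ℝ) (hF0 : 0 < F 0) (hFi : ∀ i, 1 ≤ i → i ≤ m → 0 ≤ F i)
    (hFneg : ∀ x y : C, x ≠ y →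
      ∑ i ∈ Finset.range (m + 1), F i * (p i).eval (T x y) ≤ 0) :
    (Fintype.card C : ℝ) ≤ (∑ i ∈ Finset.range (m + 1), F i * (p i).eval τ0) / F 0 := by
  classical
  have lower : F 0 * ((Fintype.card C : ℝ) * Fintype.card C) ≤
      ∑ x : C, ∑ y : C, ∑ i ∈ Finset.range (m + 1), F i * (p i).eval (T x y) := by
    have swap : ∑ x : C, ∑ y : C, ∑ i ∈ Finset.range (m + 1), F i * (p i).eval (T x y) =
        ∑ i ∈ Finset.range (m + 1), F i * ∑ x : C, ∑ y : C, (p i).eval (T x y) := by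
      simp_rw [Finset.mul_sum]
      rw [Finset.sum_comm]
      simp_rw [Finset.sum_comm (s := Finset.univ) (t := Finset.range (m + 1))]
      exact Finset.sum_congr rfl fun i _ => Finset.sum_comm
    rw [swap, Finset.sum_range_succ']
    have tail_nonneg : 0 ≤ ∑ i ∈ Finset.range m,
        F (i + 1) * ∑ x : C, ∑ y : C, (p (i + 1)).eval (T x y) :=
      Finset.sum_nonneg fun i hi => by
        have him : i + 1 ≤ m := Finset.mem_range.mp hi
        exact mul_nonneg (hFi _ (Nat.le_add_left 1 i) him) (hdelsarte _ him)
    simpa [hp0] using tail_nonneg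
  have upper : ∑ x : C, ∑ y : C, ∑ i ∈ Finset.range (m + 1), F i * (p i).eval (T x y) ≤
      Fintype.card C * ∑ i ∈ Finset.range (m + 1), F i * (p i).eval τ0 := by
    rw [← nsmul_eq_mul, ← Finset.card_univ]
    refine Finset.sum_le_card_nsmul _ _ _ fun x _ => ?_
    rw [← Finset.add_sum_erase _ _ (Finset.mem_univ x), hdiag]
    exact add_le_of_nonpos_right <| Finset.sum_nonpos fun y hy =>
      hFneg x y (Finset.ne_of_mem_erase hy).symm
  have hcard : (0 : ℝ) < Fintype.card C := by exact_mod_cast Fintype.card_pos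
  rw [le_div_iff₀ hF0]
  refine le_of_mul_le_mul_left ?_ hcard
  linarith
end

section
/- Let μ be a Borel probability measure on ℝ whose support is an infinite compact subset of an interval [a,b], and let (p_i)_{i≥0} be real polynomials with deg p_i = i, positive leading coefficients, and ∫ p_i p_j dμ = δ_{ij} (so p_0 ≡ 1). Assume that for all i, j ≥ 0 every coefficient in the expansion of the product p_i·p_j in the basis (p_l) is nonnegative. Fix ε > 0 and set P_1 = ε·p_1; let a_l, b_l, c_l ≥ 0 be the (necessarily nonnegative) coefficients in P_1·p_l = a_l p_{l+1} + b_l p_l + c_l p_{l−1} (with p_{−1} = 0), so that c_{l+1} = a_l. For k ≥ 1 let S_k be the (k+1)×(k+1) symmetric tridiagonal matrix with diagonal entries b_0,…,b_k and off-diagonal entries a_0,…,a_{k−1}, and let λmax(S_k) denote its largest eigenvalue. Let τ0 ∈ ℝ satisfy p_k(τ0) > 0 and p_{k+1}(τ0) > 0, and set ρ_k = a_k·p_{k+1}(τ0)/p_k(τ0). Let C be a nonempty finite set and T : C × C → ℝ a symmetric function with T(x,x) = τ0 for all x ∈ C and ∑_{x,y∈C} p_i(T(x,y)) ≥ 0 for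 all i ≥ 0. If λmax(S_{k−1}) ≥ P_1(T(x,y)) for all x ≠ y in C, and λmax(S_k) < P_1(τ0), then |C| ≤ 4·ρ_k·p_k(τ0)² / (P_1(τ0) − λmax(S_k)). -/
open MeasureTheory

/-- Symmetric tridiagonal (k+1)×(k+1) matrix with diagonal `d 0, …, d k` and
off-diagonal `o 0, …, o (k-1)`. -/
noncomputable def Tridiag (k : ℕ) (d o : ℕ → ℝ) : Matrix (Fin (k + 1)) (Fin (k + 1)) ℝ :=
  Matrix.of fun i j =>
    if (i : ℕ) = (j : ℕ) then d i
    else if (i : ℕ) + 1 = (j : ℕ) then o i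
    else if (j : ℕ) + 1 = (i : ℕ) then o j
    else 0

/-- The largest eigenvalue of a real square matrix. -/
noncomputable def maxEig {m : ℕ} (M : Matrix (Fin m) (Fin m) ℝ) : ℝ :=
  sSup {μ : ℝ | Module.End.HasEigenvalue (Matrix.toLin' M) μ}

/-- The topological support of a measure on ℝ. -/
def measSupport (μ : Measure ℝ) : Set ℝ := {x | ∀ U ∈ nhds x, 0 < μ U}

open Matrix in
/-- A real symmetric matrix of positive size is bounded above by its largest eigenvalue. -/
theorem maxEig_posSemidef {m : ℕ} (hm : 0 < m) {M : Matrix (Fin m) (Fin m) ℝ}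
    (hM : M.IsHermitian) :
    Module.End.HasEigenvalue (Matrix.toLin' M) (maxEig M) ∧
      (maxEig M • (1 : Matrix (Fin m) (Fin m) ℝ) - M).PosSemidef := by
  set S : Set ℝ := {μ : ℝ | Module.End.HasEigenvalue (Matrix.toLin' M) μ} with hS
  have hfin : S.Finite := Module.End.finite_hasEigenvalue _
  have hne : S.Nonempty := by
    refine ⟨hM.eigenvalues ⟨0, hm⟩, Module.End.hasEigenvalue_of_hasEigenvector
      (x := ⇑(hM.eigenvectorBasis ⟨0, hm⟩)) ⟨?_, ?_⟩⟩
    · rw [Module.End.mem_eigenspace_iff, Matrix.toLin'_apply]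
      exact hM.mulVec_eigenvectorBasis _
    · intro h
      exact hM.eigenvectorBasis.orthonormal.ne_zero ⟨0, hm⟩ (by ext i; exact congrFun h i)
  refine ⟨hne.csSup_mem hfin, ?_⟩
  have hH : (maxEig M • (1 : Matrix (Fin m) (Fin m) ℝ) - M).IsHermitian :=
    (Matrix.isHermitian_one.smul (IsSelfAdjoint.all _)).sub hM
  rw [hH.posSemidef_iff_eigenvalues_nonneg]
  intro i
  have hmem : maxEig M - hH.eigenvalues i ∈ S := by
    refine Module.End.hasEigenvalue_of_hasEigenvector
      (x := ⇑(hH.eigenvectorBasis i)) ⟨?_, ?_⟩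
    · rw [Module.End.mem_eigenspace_iff, Matrix.toLin'_apply]
      have h := hH.mulVec_eigenvectorBasis i
      rw [Matrix.sub_mulVec, Matrix.smul_mulVec, Matrix.one_mulVec] at h
      rw [sub_smul, ← h]
      abel
    · intro h
      exact hH.eigenvectorBasis.orthonormal.ne_zero i (by ext j; exact congrFun h j)
  have : maxEig M - hH.eigenvalues i ≤ maxEig M := le_csSup hfin.bddAbove hmem
  simpa using this

open Matrix in
/-- The Rayleigh bound for the largest eigenvalue of a real symmetric matrix. -/
theorem dotProduct_mulVec_le_maxEig {m : ℕ} (hm : 0 < m) {M : Matrix (Fin m) (Fin m) ℝ}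
    (hM : M.IsHermitian) (w : Fin m → ℝ) : w ⬝ᵥ (M *ᵥ w) ≤ maxEig M * (w ⬝ᵥ w) := by
  have h := (maxEig_posSemidef hm hM).2.dotProduct_mulVec_nonneg w
  rw [Matrix.sub_mulVec, Matrix.smul_mulVec, Matrix.one_mulVec, dotProduct_sub,
    dotProduct_smul] at h
  simpa using h

open Matrix in
theorem exists_mulVec_eq_maxEig {m : ℕ} (hm : 0 < m) {M : Matrix (Fin m) (Fin m) ℝ}
    (hM : M.IsHermitian) : ∃ v : Fin m → ℝ, v ≠ 0 ∧ M *ᵥ v = maxEig M • v := by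
  obtain ⟨v, hv⟩ := (maxEig_posSemidef hm hM).1.exists_hasEigenvector
  exact ⟨v, hv.2, by simpa using hv.apply_eq_smul⟩

open Matrix in
/-- Perron–Frobenius for symmetric matrices with nonnegative off-diagonal entries. -/
theorem exists_nonneg_mulVec_eq_maxEig {m : ℕ} (hm : 0 < m) {M : Matrix (Fin m) (Fin m) ℝ}
    (hM : M.IsHermitian) (hoff : ∀ i j, i ≠ j → 0 ≤ M i j) :
    ∃ v : Fin m → ℝ, v ≠ 0 ∧ (∀ i, 0 ≤ v i) ∧ M *ᵥ v = maxEig M • v := by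
  obtain ⟨v, hv0, hv⟩ := exists_mulVec_eq_maxEig hm hM
  have hle : v ⬝ᵥ (M *ᵥ v) ≤ |v| ⬝ᵥ (M *ᵥ |v|) := by
    simp only [dotProduct, Matrix.mulVec, Finset.mul_sum, Pi.abs_apply]
    refine Finset.sum_le_sum fun i _ => Finset.sum_le_sum fun j _ => ?_
    rcases eq_or_ne i j with rfl | hij
    · rw [mul_left_comm, mul_left_comm |v i|, abs_mul_abs_self]
    · have h := mul_le_mul_of_nonneg_left (le_abs_self (v i * v j)) (hoff i j hij)
      rw [abs_mul] at h
      linarith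
  have hnorm : |v| ⬝ᵥ |v| = v ⬝ᵥ v := by simp [dotProduct]
  refine ⟨|v|, by simpa using hv0, fun i => abs_nonneg _, ?_⟩
  have hpsd := (maxEig_posSemidef hm hM).2
  have hzero : star |v| ⬝ᵥ ((maxEig M • (1 : Matrix (Fin m) (Fin m) ℝ) - M) *ᵥ |v|) = 0 := by
    refine le_antisymm ?_ (hpsd.dotProduct_mulVec_nonneg _)
    rw [Matrix.sub_mulVec, Matrix.smul_mulVec, Matrix.one_mulVec, dotProduct_sub,
      dotProduct_smul, star_trivial, hnorm]
    rw [hv, dotProduct_smul] at hle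
    linarith
  have h := (hpsd.dotProduct_mulVec_zero_iff _).1 hzero
  rw [Matrix.sub_mulVec, Matrix.smul_mulVec, Matrix.one_mulVec, sub_eq_zero] at h
  exact h.symm

theorem Tridiag_symm (k : ℕ) (d o : ℕ → ℝ) (i j : Fin (k + 1)) :
    Tridiag k d o i j = Tridiag k d o j i := by
  simp only [Tridiag, Matrix.of_apply]
  split_ifs <;> first | omega | simp_all

theorem Tridiag_isHermitian (k : ℕ) (d o : ℕ → ℝ) : (Tridiag k d o).IsHermitian :=
  Matrix.IsHermitian.ext fun i j => Tridiag_symm k d o j i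

theorem Tridiag_nonneg_of_ne (k : ℕ) (d : ℕ → ℝ) {o : ℕ → ℝ} (ho : ∀ l, 0 ≤ o l)
    (i j : Fin (k + 1)) (hij : i ≠ j) : 0 ≤ Tridiag k d o i j := by
  have : (i : ℕ) ≠ j := Fin.val_ne_of_ne hij
  simp only [Tridiag, Matrix.of_apply, if_neg this]
  split_ifs <;> simp [ho]

open Matrix in
theorem Tridiag_mulVec_apply (k : ℕ) (d o g : ℕ → ℝ) (j : Fin (k + 1)) :
    (Tridiag k d o *ᵥ fun i : Fin (k + 1) => g i) j
      = (if (j : ℕ) = k then 0 else o j * g (j + 1)) + d j * g j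
        + (if (j : ℕ) = 0 then 0 else o (j - 1) * g (j - 1)) := by
  obtain ⟨j, hj⟩ := j
  simp only [Matrix.mulVec, dotProduct, Tridiag, Matrix.of_apply]
  rw [Fin.sum_univ_eq_sum_range (fun l => (if j = l then d j else if j + 1 = l then o j
    else if l + 1 = j then o l else 0) * g l) (k + 1)]
  have hsplit : ∀ l, (if j = l then d j else if j + 1 = l then o j
      else if l + 1 = j then o l else 0) * g l
      = (if j + 1 = l then o j * g l else 0) + (if j = l then d j * g l else 0)
        + (if j - 1 = l then (if j = 0 then 0 else o l * g l) else 0) := by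
    intro l
    split_ifs <;> first | omega | simp
  simp only [hsplit, Finset.sum_add_distrib, Finset.sum_ite_eq, Finset.mem_range]
  congr 1
  · congr 1
    · split_ifs <;> first | omega | rfl
    · simp [hj]
  · rw [if_pos (by omega)]

open Matrix in
theorem maxEig_Tridiag_le_succ (n : ℕ) (d o : ℕ → ℝ) :
    maxEig (Tridiag n d o) ≤ maxEig (Tridiag (n + 1) d o) := by
  obtain ⟨u, hu0, hu⟩ := exists_mulVec_eq_maxEig n.succ_pos (Tridiag_isHermitian n d o)
  have h := dotProduct_mulVec_le_maxEig (n + 1).succ_pos (Tridiag_isHermitian (n + 1) d o)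
    (Fin.snoc u 0 : Fin (n + 1 + 1) → ℝ)
  have hsq : (Fin.snoc u 0 : Fin (n + 1 + 1) → ℝ) ⬝ᵥ (Fin.snoc u 0) = u ⬝ᵥ u := by
    simp [dotProduct, Fin.sum_univ_castSucc (n := n + 1)]
  have hquad : (Fin.snoc u 0 : Fin (n + 1 + 1) → ℝ) ⬝ᵥ
      (Tridiag (n + 1) d o *ᵥ (Fin.snoc u 0 : Fin (n + 1 + 1) → ℝ))
      = u ⬝ᵥ (Tridiag n d o *ᵥ u) := by
    simp [dotProduct, Matrix.mulVec, Fin.sum_univ_castSucc (n := n + 1), Tridiag]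
  rw [hsq, hquad, hu, dotProduct_smul, smul_eq_mul] at h
  have hpos : 0 < u ⬝ᵥ u := by simpa using dotProduct_star_self_pos_iff.2 hu0
  exact le_of_mul_le_mul_right h hpos

open Matrix in
theorem maxEig_Tridiag_mono (n : ℕ) {d d' : ℕ → ℝ} (hd : ∀ i, d i ≤ d' i) (o : ℕ → ℝ) :
    maxEig (Tridiag n d o) ≤ maxEig (Tridiag n d' o) := by
  obtain ⟨u, hu0, hu⟩ := exists_mulVec_eq_maxEig n.succ_pos (Tridiag_isHermitian n d o)
  have h := dotProduct_mulVec_le_maxEig n.succ_pos (Tridiag_isHermitian n d' o) u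
  have hle : u ⬝ᵥ (Tridiag n d o *ᵥ u) ≤ u ⬝ᵥ (Tridiag n d' o *ᵥ u) := by
    simp only [dotProduct, Matrix.mulVec, Finset.mul_sum]
    refine Finset.sum_le_sum fun i _ => Finset.sum_le_sum fun j _ => ?_
    rcases eq_or_ne i j with rfl | hij
    · simp only [Tridiag, Matrix.of_apply, if_true]
      nlinarith [mul_le_mul_of_nonneg_right (hd i) (mul_self_nonneg (u i))]
    · have : (i : ℕ) ≠ j := Fin.val_ne_of_ne hij
      simp [Tridiag, this]
  rw [hu, dotProduct_smul, smul_eq_mul] at hle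
  have hpos : 0 < u ⬝ᵥ u := by simpa using dotProduct_star_self_pos_iff.2 hu0
  exact le_of_mul_le_mul_right (hle.trans h) hpos

theorem Tridiag_update_of_lt {n k : ℕ} (hnk : n < k) (d o : ℕ → ℝ) (t : ℝ) :
    Tridiag n (Function.update d k t) o = Tridiag n d o := by
  ext i j
  have : (i : ℕ) ≠ k := by omega
  simp [Tridiag, this]

/-- Eigenvectors of the truncated Jacobi matrix with its last diagonal entry lowered by `r`
satisfy a truncated recurrence as polynomials. -/
theorem sub_mul_sum_eq_of_mulVec_eq {P : ℝ} {g A B c : ℕ → ℝ}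
    (hrec : ∀ l, P * g l = A l * g (l + 1) + B l * g l + (if l = 0 then 0 else c l * g (l - 1)))
    (hca : ∀ l, c (l + 1) = A l) (k : ℕ) (r θ : ℝ) (f : Fin (k + 1) → ℝ)
    (hf : (Tridiag k (Function.update B k (B k - r)) A).mulVec f = θ • f) :
    (P - θ) * ∑ i, f i * g i = f (Fin.last k) * (r * g k + A k * g (k + 1)) := by
  set M := Tridiag k (Function.update B k (B k - r)) A with hM
  have hrow : ∀ j : Fin (k + 1), M.mulVec (fun i : Fin (k + 1) => g i) j
      = P * g j - (if j = Fin.last k then r * g k + A k * g (k + 1) else 0) := by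
    intro j
    have hc : (if (j : ℕ) = 0 then 0 else c j * g (j - 1))
        = (if (j : ℕ) = 0 then 0 else A (j - 1) * g (j - 1)) := by
      obtain ⟨j, hj⟩ := j
      cases j <;> simp [hca]
    rw [hM, Tridiag_mulVec_apply, hrec j, hc]
    rcases eq_or_ne j (Fin.last k) with rfl | hj
    · simp only [Fin.val_last, Function.update_self, if_true]
      ring
    · have hjk : (j : ℕ) ≠ k := fun h => hj (Fin.ext h)
      simp [hj, hjk]
  have hsym : f ⬝ᵥ M.mulVec (fun i : Fin (k + 1) => g i)
      = (fun i : Fin (k + 1) => g i) ⬝ᵥ M.mulVec f := by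
    rw [Matrix.dotProduct_mulVec, dotProduct_comm, ← Matrix.mulVec_transpose]
    congr 2
    ext i j
    exact Tridiag_symm _ _ _ _ _
  rw [hf, dotProduct_smul] at hsym
  simp only [dotProduct, hrow, mul_sub, Finset.sum_sub_distrib, mul_ite, mul_zero,
    Finset.sum_ite_eq', Finset.mem_univ, if_true, smul_eq_mul] at hsym
  rw [sub_mul, Finset.mul_sum, Finset.mul_sum]
  rw [Finset.mul_sum] at hsym
  have h1 : ∑ i, P * (f i * g i) = ∑ i, f i * (P * g i) :=
    Finset.sum_congr rfl fun i _ => by ring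
  have h2 : ∑ i, θ * (f i * g i) = ∑ i : Fin (k + 1), θ * (g i * f i) :=
    Finset.sum_congr rfl fun i _ => by ring
  rw [h1, h2]
  linarith

section Orthonormal

variable {μ : Measure ℝ} [IsProbabilityMeasure μ] {p : ℕ → Polynomial ℝ}

theorem eval_zero_eq_one (hdeg : ∀ i, (p i).natDegree = i) (hlead : ∀ i, 0 < (p i).leadingCoeff)
    (horth : ∀ i j, ∫ x, (p i).eval x * (p j).eval x ∂μ = if i = j then 1 else 0) (x : ℝ) :
    (p 0).eval x = 1 := by
  have hC := Polynomial.eq_C_of_natDegree_eq_zero (hdeg 0)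
  have hl := hlead 0
  have ho := horth 0 0
  rw [Polynomial.leadingCoeff, hdeg 0] at hl
  rw [hC] at ho ⊢
  simp only [Polynomial.eval_C, integral_const, probReal_univ, smul_eq_mul, one_mul,
    if_true] at ho ⊢
  nlinarith

theorem integrable_eval
    (horth : ∀ i j, ∫ x, (p i).eval x * (p j).eval x ∂μ = if i = j then 1 else 0) (l : ℕ) :
    Integrable (fun x => (p l).eval x) μ := by
  have hsq : Integrable (fun x => (p l).eval x ^ 2) μ := by
    refine Integrable.of_integral_ne_zero ?_
    simp only [sq]
    rw [horth]
    simp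
  exact ((memLp_two_iff_integrable_sq
    (p l).continuous.aestronglyMeasurable).2 hsq).integrable one_le_two

theorem linearization_coeff_zero (hdeg : ∀ i, (p i).natDegree = i)
    (hlead : ∀ i, 0 < (p i).leadingCoeff)
    (horth : ∀ i j, ∫ x, (p i).eval x * (p j).eval x ∂μ = if i = j then 1 else 0)
    {i j : ℕ} {q : ℕ → ℝ} (hq : ∀ x : ℝ, (p i).eval x * (p j).eval x
      = ∑ l ∈ Finset.range (i + j + 1), q l * (p l).eval x) :
    q 0 = if i = j then 1 else 0 := by
  have hint : ∀ l, ∫ x, (p l).eval x ∂μ = if l = 0 then 1 else 0 := by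
    intro l
    rw [← horth l 0]
    simp [eval_zero_eq_one hdeg hlead horth]
  rw [← horth i j]
  simp only [hq]
  rw [integral_finsetSum _ fun l _ => (integrable_eval horth l).const_mul _]
  simp [integral_const_mul, hint]

/-- The Delsarte inequalities for products of the orthonormal polynomials. -/
theorem card_sq_le_sum_eval_mul (hdeg : ∀ i, (p i).natDegree = i)
    (hlead : ∀ i, 0 < (p i).leadingCoeff)
    (horth : ∀ i j, ∫ x, (p i).eval x * (p j).eval x ∂μ = if i = j then 1 else 0)
    (hlin : ∀ i j, ∃ q : ℕ → ℝ, (∀ l, 0 ≤ q l) ∧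
      ∀ x : ℝ, (p i).eval x * (p j).eval x
        = ∑ l ∈ Finset.range (i + j + 1), q l * (p l).eval x)
    {C : Type*} [Fintype C] {T : C → C → ℝ}
    (hdelsarte : ∀ i : ℕ, 0 ≤ ∑ x : C, ∑ y : C, (p i).eval (T x y)) (i j : ℕ) :
    (if i = j then (Fintype.card C : ℝ) ^ 2 else 0)
      ≤ ∑ x : C, ∑ y : C, (p i).eval (T x y) * (p j).eval (T x y) := by
  obtain ⟨q, hq0, hq⟩ := hlin i j
  have hswap : ∑ x : C, ∑ y : C, (p i).eval (T x y) * (p j).eval (T x y)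
      = ∑ l ∈ Finset.range (i + j + 1), q l * ∑ x : C, ∑ y : C, (p l).eval (T x y) := by
    simp only [hq, Finset.mul_sum]
    rw [Finset.sum_comm]
    simp_rw [Finset.sum_comm (s := Finset.univ) (t := Finset.range (i + j + 1))]
    exact Finset.sum_congr rfl fun l _ => Finset.sum_comm
  rw [hswap]
  refine le_trans (le_of_eq ?_) (Finset.single_le_sum
    (f := fun l => q l * ∑ x : C, ∑ y : C, (p l).eval (T x y))
    (fun l _ => mul_nonneg (hq0 l) (hdelsarte l)) (Finset.mem_range.2 (Nat.succ_pos (i + j))))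
  simp [linearization_coeff_zero hdeg hlead horth hq, eval_zero_eq_one hdeg hlead horth, sq]

end Orthonormal

theorem pos_of_three_term_recurrence {p : ℕ → Polynomial ℝ} (hdeg : ∀ i, (p i).natDegree = i)
    (hlead : ∀ i, 0 < (p i).leadingCoeff) {ε : ℝ} (hε : 0 < ε) {A B c : ℕ → ℝ}
    (hA : ∀ l, 0 ≤ A l)
    (hrec : ∀ (l : ℕ) (x : ℝ), (Polynomial.C ε * p 1).eval x * (p l).eval x
      = A l * (p (l + 1)).eval x + B l * (p l).eval x
        + (if l = 0 then 0 else c l * (p (l - 1)).eval x)) (k : ℕ) :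
    0 < A k := by
  refine (hA k).lt_of_ne' fun h0 => ?_
  have hpoly : Polynomial.C ε * p 1 * p k = Polynomial.C (B k) * p k
      + Polynomial.C (if k = 0 then 0 else c k) * p (k - 1) := by
    refine Polynomial.funext fun x => ?_
    rw [Polynomial.eval_mul, hrec, h0]
    split_ifs <;> simp
  have hne : ∀ i, p i ≠ 0 := fun i => Polynomial.leadingCoeff_ne_zero.1 (hlead i).ne'
  have hC : Polynomial.C ε ≠ 0 := Polynomial.C_ne_zero.2 hε.ne'
  have hd := congrArg Polynomial.natDegree hpoly
  rw [Polynomial.natDegree_mul (mul_ne_zero hC (hne 1)) (hne k),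
    Polynomial.natDegree_mul hC (hne 1), Polynomial.natDegree_C, hdeg, hdeg] at hd
  have hle : (Polynomial.C (B k) * p k
      + Polynomial.C (if k = 0 then 0 else c k) * p (k - 1)).natDegree ≤ k := by
    refine Polynomial.natDegree_add_le_of_degree_le
      ((Polynomial.natDegree_C_mul_le _ _).trans (hdeg k).le)
      ((Polynomial.natDegree_C_mul_le _ _).trans ?_)
    rw [hdeg]
    omega
  omega

theorem eq_zero_of_sum_smul_eq_zero {p : ℕ → Polynomial ℝ} (hdeg : ∀ i, (p i).natDegree = i)
    (hlead : ∀ i, 0 < (p i).leadingCoeff) {n : ℕ} {f : Fin n → ℝ}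
    (hf : ∑ i, f i • p i = 0) : f = 0 := by
  let s : Polynomial.Sequence ℝ := ⟨p, fun i => by
    rw [Polynomial.degree_eq_natDegree (Polynomial.leadingCoeff_ne_zero.1 (hlead i).ne'), hdeg]⟩
  have := s.linearIndependent.comp (fun i : Fin n => (i : ℕ)) Fin.val_injective
  rw [Fintype.linearIndependent_iff] at this
  exact funext (this f hf)

/-- The main spectral linear programming bound (Theorem 2 of the paper). -/
theorem spectral_lp_bound
    (μ : Measure ℝ) [IsProbabilityMeasure μ] (a b : ℝ)
    (hcomp : IsCompact (measSupport μ)) (hinf : (measSupport μ).Infinite)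
    (hsub : measSupport μ ⊆ Set.Icc a b)
    (p : ℕ → Polynomial ℝ)
    (hdeg : ∀ i, (p i).natDegree = i) (hlead : ∀ i, 0 < (p i).leadingCoeff)
    (horth : ∀ i j, ∫ x, (p i).eval x * (p j).eval x ∂μ = if i = j then 1 else 0)
    (hlin : ∀ i j, ∃ q : ℕ → ℝ, (∀ l, 0 ≤ q l) ∧
      ∀ x : ℝ, (p i).eval x * (p j).eval x
        = ∑ l ∈ Finset.range (i + j + 1), q l * (p l).eval x)
    (ε : ℝ) (hε : 0 < ε) (P1 : Polynomial ℝ) (hP1 : P1 = Polynomial.C ε * p 1)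
    (A B c : ℕ → ℝ) (hA : ∀ l, 0 ≤ A l) (hB : ∀ l, 0 ≤ B l) (hc : ∀ l, 0 ≤ c l)
    (hrec : ∀ (l : ℕ) (x : ℝ), P1.eval x * (p l).eval x
      = A l * (p (l + 1)).eval x + B l * (p l).eval x
        + (if l = 0 then 0 else c l * (p (l - 1)).eval x))
    (hca : ∀ l, c (l + 1) = A l)
    (k : ℕ) (hk : 1 ≤ k)
    (τ0 : ℝ) (hpk : 0 < (p k).eval τ0) (hpk1 : 0 < (p (k + 1)).eval τ0)
    (C : Type*) [Fintype C] [Nonempty C]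
    (T : C → C → ℝ) (hsym : ∀ x y, T x y = T y x) (hdiag : ∀ x, T x x = τ0)
    (hdelsarte : ∀ i : ℕ, 0 ≤ ∑ x : C, ∑ y : C, (p i).eval (T x y))
    (hcond1 : ∀ x y : C, x ≠ y → P1.eval (T x y) ≤ maxEig (Tridiag (k - 1) B A))
    (hcond2 : maxEig (Tridiag k B A) < P1.eval τ0) :
    (Fintype.card C : ℝ)
      ≤ 4 * (A k * (p (k + 1)).eval τ0 / (p k).eval τ0) * ((p k).eval τ0) ^ 2
        / (P1.eval τ0 - maxEig (Tridiag k B A)) := by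
  have hApos : 0 < A k := pos_of_three_term_recurrence hdeg hlead hε hA (hP1 ▸ hrec) k
  set r : ℝ := A k * (p (k + 1)).eval τ0 / (p k).eval τ0 with hr
  have hrpos : 0 < r := div_pos (mul_pos hApos hpk1) hpk
  have hrp : r * (p k).eval τ0 = A k * (p (k + 1)).eval τ0 := div_mul_cancel₀ _ hpk.ne'
  set B' : ℕ → ℝ := Function.update B k (B k - r) with hB'
  obtain ⟨f, hf0, hfnn, hf⟩ := exists_nonneg_mulVec_eq_maxEig k.succ_pos
    (Tridiag_isHermitian k B' A) (Tridiag_nonneg_of_ne k B' hA)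
  set θ : ℝ := maxEig (Tridiag k B' A) with hθ
  have hlow : maxEig (Tridiag (k - 1) B A) ≤ θ := by
    obtain ⟨n, rfl⟩ : ∃ n, k = n + 1 := ⟨k - 1, by omega⟩
    rw [Nat.add_sub_cancel, ← Tridiag_update_of_lt n.lt_succ_self B A (B (n + 1) - r)]
    exact maxEig_Tridiag_le_succ n B' A
  have hup : θ ≤ maxEig (Tridiag k B A) := by
    refine maxEig_Tridiag_mono k (fun i => ?_) A
    rcases eq_or_ne i k with rfl | hi
    · simp [hB', hrpos.le]
    · simp [hB', hi]
  have hker : ∀ x : ℝ, (P1.eval x - θ) * ∑ i, f i * (p i).eval x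
      = f (Fin.last k) * (r * (p k).eval x + A k * (p (k + 1)).eval x) := fun x =>
    sub_mul_sum_eq_of_mulVec_eq (g := fun i => (p i).eval x) (fun l => hrec l x) hca k r θ f hf
  have hfk : 0 < f (Fin.last k) := by
    refine (hfnn _).lt_of_ne' fun h0 => hf0 (eq_zero_of_sum_smul_eq_zero hdeg hlead ?_)
    have hmul : (P1 - Polynomial.C θ) * ∑ i, f i • p i = 0 := by
      refine Polynomial.funext fun x => ?_
      simpa [Polynomial.eval_finsetSum, h0] using hker x
    refine (mul_eq_zero.1 hmul).resolve_left fun h => ?_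
    have hd := congrArg Polynomial.natDegree (sub_eq_zero.1 h)
    rw [hP1, Polynomial.natDegree_C_mul hε.ne', hdeg, Polynomial.natDegree_C] at hd
    exact one_ne_zero hd
  have hcard : (0 : ℝ) < Fintype.card C := by exact_mod_cast Fintype.card_pos
  set N : ℝ := (Fintype.card C : ℝ) with hN
  set F : ℝ → ℝ := fun x => (P1.eval x - θ) * (∑ i, f i * (p i).eval x) ^ 2 with hF
  have hFexp : ∀ x, F x = ∑ i, f (Fin.last k) * f i
      * (r * ((p k).eval x * (p i).eval x) + A k * ((p (k + 1)).eval x * (p i).eval x)) := by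
    intro x
    rw [hF]
    simp only
    rw [sq, ← mul_assoc, hker, Finset.mul_sum]
    exact Finset.sum_congr rfl fun i _ => by ring
  have hlower : f (Fin.last k) ^ 2 * r * N ^ 2 ≤ ∑ x : C, ∑ y : C, F (T x y) := by
    have hswap : ∑ x : C, ∑ y : C, F (T x y) = ∑ i, f (Fin.last k) * f i
        * (r * ∑ x : C, ∑ y : C, (p k).eval (T x y) * (p i).eval (T x y)
          + A k * ∑ x : C, ∑ y : C, (p (k + 1)).eval (T x y) * (p i).eval (T x y)) := by
      simp only [hFexp]
      simp_rw [Finset.sum_comm (s := (Finset.univ : Finset C))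
        (t := (Finset.univ : Finset (Fin (k + 1))))]
      simp only [Finset.mul_sum, ← Finset.sum_add_distrib]
    have hterm : ∀ i : Fin (k + 1), (if i = Fin.last k then f (Fin.last k) ^ 2 * r * N ^ 2 else 0)
        ≤ f (Fin.last k) * f i
        * (r * ∑ x : C, ∑ y : C, (p k).eval (T x y) * (p i).eval (T x y)
          + A k * ∑ x : C, ∑ y : C, (p (k + 1)).eval (T x y) * (p i).eval (T x y)) := by
      intro i
      have h1 := card_sq_le_sum_eval_mul hdeg hlead horth hlin hdelsarte k i
      have h2 := card_sq_le_sum_eval_mul hdeg hlead horth hlin hdelsarte (k + 1) i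
      rw [if_neg (by omega)] at h2
      have h3 := mul_nonneg hApos.le h2
      have h4 := mul_le_mul_of_nonneg_left h1 hrpos.le
      have h5 := mul_le_mul_of_nonneg_left (add_le_add h4 h3) (mul_nonneg hfk.le (hfnn i))
      refine le_trans (le_of_eq ?_) h5
      rcases eq_or_ne i (Fin.last k) with rfl | hi
      · simp only [Fin.val_last, if_true]
        ring
      · have : k ≠ (i : ℕ) := fun h => hi (Fin.ext h.symm)
        simp [hi, this]
    rw [hswap]
    refine le_trans (le_of_eq ?_) (Finset.sum_le_sum fun i _ => hterm i)
    simp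
  have hupper : ∑ x : C, ∑ y : C, F (T x y) ≤ N * F τ0 := by
    classical
    have hle : ∀ x y : C, F (T x y) ≤ if x = y then F τ0 else 0 := by
      intro x y
      split_ifs with hxy
      · rw [hxy, hdiag]
      · exact mul_nonpos_of_nonpos_of_nonneg
          (sub_nonpos.2 ((hcond1 x y hxy).trans hlow)) (sq_nonneg _)
    refine (Finset.sum_le_sum fun x _ => Finset.sum_le_sum fun y _ => hle x y).trans
      (le_of_eq ?_)
    simp [hN]
  have hgap : 0 < P1.eval τ0 - maxEig (Tridiag k B A) := sub_pos.2 hcond2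
  have hFτ : (P1.eval τ0 - θ) * F τ0
      = f (Fin.last k) ^ 2 * (4 * r ^ 2 * (p k).eval τ0 ^ 2) := by
    have h := hker τ0
    rw [← hrp] at h
    calc (P1.eval τ0 - θ) * F τ0
        = ((P1.eval τ0 - θ) * ∑ i, f i * (p i).eval τ0) ^ 2 := by rw [hF]; ring
      _ = _ := by rw [h]; ring
  have hNF : f (Fin.last k) ^ 2 * r * N ≤ F τ0 := by
    refine le_of_mul_le_mul_left ?_ hcard
    linarith [hlower.trans hupper]
  have hmain : (f (Fin.last k) ^ 2 * r) * (N * (P1.eval τ0 - θ))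
      ≤ (f (Fin.last k) ^ 2 * r) * (4 * r * (p k).eval τ0 ^ 2) := by
    have h := mul_le_mul_of_nonneg_left hNF (by linarith : 0 ≤ P1.eval τ0 - θ)
    rw [hFτ] at h
    linarith
  rw [le_div_iff₀ hgap]
  calc N * (P1.eval τ0 - maxEig (Tridiag k B A)) ≤ N * (P1.eval τ0 - θ) := by gcongr
    _ ≤ _ := le_of_mul_le_mul_left hmain (by positivity)
end

section
/- Let μ be a Borel probability measure on ℝ whose support is an infinite compact set, and let (p_i)_{i≥0} be real polynomials with deg p_i = i, positive leading coefficients, and ∫ p_i p_j dμ = δ_{ij}, satisfying the three-term recurrence x·p_l(x) = α_l p_{l+1}(x) + β_l p_l(x) + γ_l p_{l−1}(x) with α_l > 0 and γ_{l+1} = α_l (p_{−1} = 0). Let X_k be the (k+1)×(k+1) symmetric tridiagonal matrix with diagonal entries β_0,…,β_k and off-diagonal entries α_0,…,α_{k−1}. Then a real number λ is an eigenvalue of X_k if and only if p_{k+1}(λ) = 0. -/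
open MeasureTheory

/-- Action of a tridiagonal matrix on the truncation of a sequence. -/
theorem tridiag_mulVec_apply (k : ℕ) (d o u : ℕ → ℝ) (i : Fin (k + 1)) :
    (Tridiag k d o).mulVec (fun j => u j) i
      = d i * u i + (if (i : ℕ) < k then o i * u (i + 1) else 0)
        + (if (i : ℕ) = 0 then 0 else o (i - 1) * u (i - 1)) := by
  obtain ⟨i, hi⟩ := i
  have hsplit : ∀ j : Fin (k + 1), Tridiag k d o ⟨i, hi⟩ j * u j
      = (if i = (j : ℕ) then d i * u i else 0)
        + (if i + 1 = (j : ℕ) then o i * u (i + 1) else 0)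
        + (if (j : ℕ) + 1 = i then o (i - 1) * u (i - 1) else 0) := by
    intro ⟨j, hj⟩
    simp only [Tridiag, Matrix.of_apply]
    split_ifs <;> first | omega | (subst_vars; simp)
  have hprev : ∑ j ∈ Finset.range (k + 1), (if j + 1 = i then o (i - 1) * u (i - 1) else 0)
      = if i = 0 then 0 else o (i - 1) * u (i - 1) := by
    rcases i with _ | i
    · simp
    · simp [Finset.sum_ite_eq', show i < k + 1 by omega]
  simp only [Matrix.mulVec, dotProduct, hsplit, Finset.sum_add_distrib]
  rw [Fin.sum_univ_eq_sum_range (fun j => if i = j then d i * u i else 0),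
    Fin.sum_univ_eq_sum_range (fun j => if i + 1 = j then o i * u (i + 1) else 0),
    Fin.sum_univ_eq_sum_range (fun j => if j + 1 = i then o (i - 1) * u (i - 1) else 0), hprev]
  simp [Finset.sum_ite_eq, hi]

/-- Two solutions of the same three-term recurrence are proportional. -/
theorem three_term_recurrence_proportional {n : ℕ} {d o u q : ℕ → ℝ} {c : ℝ}
    (ho : ∀ l, o l ≠ 0)
    (hu : ∀ l < n, c * u l = d l * u l + o l * u (l + 1)
      + (if l = 0 then 0 else o (l - 1) * u (l - 1)))
    (hq : ∀ l < n, c * q l = d l * q l + o l * q (l + 1)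
      + (if l = 0 then 0 else o (l - 1) * q (l - 1))) :
    ∀ l ≤ n, q 0 * u l = u 0 * q l := by
  intro l
  induction l using Nat.strong_induction_on with
  | _ l ih =>
    intro hl
    rcases l with _ | l
    · ring
    have h₁ := hu l (by omega)
    have h₂ := hq l (by omega)
    have ih₁ := ih l (by omega) (by omega)
    apply mul_left_cancel₀ (ho l)
    rcases l with _ | l
    · simp only [if_true] at h₁ h₂
      linear_combination u 0 * h₂ - q 0 * h₁
    · have ih₂ := ih l (by omega) (by omega)
      simp only [Nat.add_eq_zero_iff, one_ne_zero, and_false, if_false,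
        Nat.add_sub_cancel] at h₁ h₂
      linear_combination u 0 * h₂ - q 0 * h₁ + (c - d (l + 1)) * ih₁ - o l * ih₂

/-- The eigenvalues of the Jacobi matrix $X_k$ of a family of orthonormal polynomials
are exactly the zeros of $p_{k+1}$ (Remark 2 of the paper). -/
theorem jacobi_matrix_eigenvalues_iff_roots
    (μ : Measure ℝ) [IsProbabilityMeasure μ]
    (hcomp : IsCompact (measSupport μ)) (hinf : (measSupport μ).Infinite)
    (p : ℕ → Polynomial ℝ)
    (hdeg : ∀ i, (p i).natDegree = i) (hlead : ∀ i, 0 < (p i).leadingCoeff)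
    (horth : ∀ i j, ∫ x, (p i).eval x * (p j).eval x ∂μ = if i = j then 1 else 0)
    (α β γ : ℕ → ℝ) (hα : ∀ l, 0 < α l) (hγα : ∀ l, γ (l + 1) = α l)
    (hrec : ∀ (l : ℕ) (x : ℝ), x * (p l).eval x
      = α l * (p (l + 1)).eval x + β l * (p l).eval x
        + (if l = 0 then 0 else γ l * (p (l - 1)).eval x))
    (k : ℕ) (lam : ℝ) :
    Module.End.HasEigenvalue (Matrix.toLin' (Tridiag k β α)) lam
      ↔ (p (k + 1)).eval lam = 0 := by
  have hp0 : (p 0).eval lam ≠ 0 := by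
    have h := hlead 0
    rw [Polynomial.leadingCoeff, hdeg] at h
    rw [Polynomial.eq_C_of_natDegree_eq_zero (hdeg 0), Polynomial.eval_C]
    exact h.ne'
  have hq : ∀ l, lam * (p l).eval lam = β l * (p l).eval lam + α l * (p (l + 1)).eval lam
      + (if l = 0 then 0 else α (l - 1) * (p (l - 1)).eval lam) := by
    intro l
    rw [hrec l lam]
    rcases l with _ | l
    · simp only [if_true]
      ring
    · simp only [Nat.add_eq_zero_iff, one_ne_zero, and_false, if_false, Nat.add_sub_cancel, hγα]
      ring
  constructor
  · intro h
    obtain ⟨v, hv⟩ := h.exists_hasEigenvector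
    have hmul := hv.apply_eq_smul
    rw [Matrix.toLin'_apply] at hmul
    let u : ℕ → ℝ := fun j => if h : j < k + 1 then v ⟨j, h⟩ else 0
    have huv : v = fun j : Fin (k + 1) => u j := by
      ext j
      simp only [u, dif_pos j.2]
    have hend : u (k + 1) = 0 := by simp [u]
    have hu : ∀ l < k + 1, lam * u l = β l * u l + α l * u (l + 1)
        + (if l = 0 then 0 else α (l - 1) * u (l - 1)) := by
      intro l hl
      have hi := congrFun hmul ⟨l, hl⟩
      rw [huv, tridiag_mulVec_apply] at hi
      simp only [Pi.smul_apply, smul_eq_mul] at hi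
      rw [← hi]
      by_cases hlk : l < k
      · simp [hlk]
      · obtain rfl : l = k := by omega
        simp [hend]
    have hprop := three_term_recurrence_proportional (q := fun l => (p l).eval lam)
      (fun l => (hα l).ne') hu (fun l _ => hq l)
    have hlast := hprop (k + 1) le_rfl
    rw [hend, mul_zero] at hlast
    refine (mul_eq_zero.mp hlast.symm).resolve_left fun h0 => hv.2 ?_
    rw [huv]
    ext j
    have hj := hprop j j.2.le
    rw [h0, zero_mul] at hj
    exact (mul_eq_zero.mp hj).resolve_left hp0
  · intro hroot
    refine Module.End.hasEigenvalue_of_hasEigenvector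
      (x := fun j : Fin (k + 1) => (p j).eval lam) ⟨?_, ?_⟩
    · rw [Module.End.mem_eigenspace_iff, Matrix.toLin'_apply]
      ext i
      rw [tridiag_mulVec_apply k β α (fun j => (p j).eval lam), Pi.smul_apply, smul_eq_mul, hq i]
      by_cases hik : (i : ℕ) < k
      · simp [hik]
      · have hi : (i : ℕ) = k := by omega
        simp [hi, hroot]
    · intro h
      exact hp0 (congrFun h 0)
end

section
/- Let n ≥ 1 and 0 ≤ k ≤ n, and define the Krawtchouk polynomial K_k(x) = ∑_{j=0}^{k} (−1)^j · C(x,j) · C(n−x, k−j), where C(m,j) denotes the binomial coefficient of nonnegative integers. Then for every finite nonempty set C ⊆ {0,1}^n one has ∑_{x∈C} ∑_{y∈C} K_k(d_H(x,y)) ≥ 0, where d_H denotes the Hamming distance. -/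
/-- The Krawtchouk polynomial `K_k` of the binary Hamming space of length `n`,
evaluated at a nonnegative integer `x`. -/
noncomputable def krawtchouk (n k x : ℕ) : ℝ :=
  ∑ j ∈ Finset.range (k + 1), (-1 : ℝ) ^ j * (Nat.choose x j) * (Nat.choose (n - x) (k - j))

open Polynomial in
/-- The generating function of the Krawtchouk polynomials. -/
theorem krawtchouk_eq_coeff (n k x : ℕ) :
    krawtchouk n k x = ((1 + C (-1 : ℝ) * X) ^ x * (1 + C (1 : ℝ) * X) ^ (n - x)).coeff k := by
  have h (r : ℝ) (m j : ℕ) : ((1 + C r * X) ^ m).coeff j = r ^ j * m.choose j := by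
    have : (1 + C r * X) ^ m = ((1 + X : ℝ[X]) ^ m).comp (C r * X) := by simp
    rw [this, comp_C_mul_X_coeff, coeff_one_add_X_pow, mul_comm]
  rw [coeff_mul, Finset.Nat.sum_antidiagonal_eq_sum_range_succ_mk, krawtchouk]
  simp_rw [h, one_pow, one_mul]

open Polynomial in
/-- The elementary symmetric polynomials as coefficients of `∏ i, (1 + f i * X)`. -/
theorem coeff_prod_one_add_C_mul_X {ι R : Type*} [CommSemiring R] (s : Finset ι) (f : ι → R)
    (k : ℕ) :
    (∏ i ∈ s, (1 + C (f i) * X)).coeff k = ∑ t ∈ s.powersetCard k, ∏ i ∈ t, f i := by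
  rw [Finset.prod_one_add, finsetSum_coeff, Finset.powersetCard_eq_filter,
    Finset.sum_filter]
  refine Finset.sum_congr rfl fun t _ ↦ ?_
  rw [Finset.prod_mul_distrib, Finset.prod_const, ← map_prod, coeff_C_mul, coeff_X_pow]
  simp [eq_comm]

/-- The Krawtchouk kernel is the sum of the characters of weight `k`. -/
theorem krawtchouk_hammingDist (n k : ℕ) (x y : Fin n → Bool) :
    krawtchouk n k (hammingDist x y) =
      ∑ t ∈ (Finset.univ : Finset (Fin n)).powersetCard k,
        (∏ i ∈ t, if x i then (-1 : ℝ) else 1) * ∏ i ∈ t, if y i then (-1 : ℝ) else 1 := by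
  have h (i : Fin n) : (if x i then (-1 : ℝ) else 1) * (if y i then (-1 : ℝ) else 1) =
      if x i ≠ y i then -1 else 1 := by
    cases x i <;> cases y i <;> simp
  have hcard : (Finset.univ.filter fun i ↦ ¬ x i ≠ y i).card = n - hammingDist x y := by
    have := Finset.card_filter_add_card_filter_not (s := Finset.univ) fun i ↦ x i ≠ y i
    rw [Finset.card_univ, Fintype.card_fin] at this
    exact Nat.eq_sub_of_add_eq' this
  simp_rw [← Finset.prod_mul_distrib, h]
  rw [← coeff_prod_one_add_C_mul_X, krawtchouk_eq_coeff, ← hcard, hammingDist,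
    ← Finset.prod_const, ← Finset.prod_const,
    ← Finset.prod_filter_mul_prod_filter_not Finset.univ fun i ↦ x i ≠ y i]
  congr 2
  · exact Finset.prod_congr rfl fun i hi ↦ by rw [if_pos (Finset.mem_filter.mp hi).2]
  · exact Finset.prod_congr rfl fun i hi ↦ by rw [if_neg (Finset.mem_filter.mp hi).2]

/-- The Delsarte inequalities for the binary Hamming space: the Krawtchouk kernels are
positive semidefinite. -/
theorem krawtchouk_delsarte_inequality (n k : ℕ) (hn : 1 ≤ n) (hk : k ≤ n)
    (C : Finset (Fin n → Bool)) (hC : C.Nonempty) :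
    0 ≤ ∑ x ∈ C, ∑ y ∈ C, krawtchouk n k (hammingDist x y) := by
  simp_rw [krawtchouk_hammingDist]
  rw [Finset.sum_congr rfl fun x _ ↦ Finset.sum_comm, Finset.sum_comm]
  refine Finset.sum_nonneg fun t _ ↦ ?_
  rw [← Finset.sum_mul_sum]
  exact mul_self_nonneg _
end

section
/- Fix δ ∈ (0, 1/2) and ε > 0. Then there exists N such that for every n ≥ N, every code C ⊆ {0,1}^n whose minimum Hamming distance is at least δ·n satisfies (1/n)·log₂|C| ≤ h(1/2 − √(δ(1−δ))) + ε. -/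
/-- The binary entropy function (base-2 logarithm). -/
noncomputable def binEnt (x : ℝ) : ℝ := -x * Real.logb 2 x - (1 - x) * Real.logb 2 (1 - x)

open Finset

/-- The sign `-1` or `1` attached to a bit. -/
def bitSign (b : Bool) : ℝ := if b then -1 else 1

/-- The Walsh character of the Boolean cube. -/
def walsh {ι : Type*} [Fintype ι] (z x : ι → Bool) : ℝ :=
  ∏ i, if z i then bitSign (x i) else 1

/-- Flip one bit of a point of the Boolean cube. -/
def flipBit {ι : Type*} [DecidableEq ι] (i : ι) (z : ι → Bool) : ι → Bool :=
  Function.update z i (!z i)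

/-- The Hamming weight. -/
def bitWeight {ι : Type*} [Fintype ι] (z : ι → Bool) : ℕ := #{i | z i = true}

lemma bitSign_mul_self (b : Bool) : bitSign b * bitSign b = 1 := by
  cases b <;> simp [bitSign]

lemma flipBit_involutive {ι : Type*} [DecidableEq ι] (i : ι) :
    Function.Involutive (flipBit i) := fun z => by
  simp [flipBit]

section Cube

variable {ι : Type*} [Fintype ι]

lemma walsh_mul_self (z x : ι → Bool) : walsh z x * walsh z x = 1 := by
  rw [walsh, ← prod_mul_distrib]
  refine prod_eq_one fun i _ => ?_
  split_ifs <;> simp [bitSign_mul_self]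

lemma sum_bitSign_mul (x y : ι → Bool) :
    ∑ i, bitSign (x i) * bitSign (y i) = Fintype.card ι - 2 * (hammingDist x y : ℝ) := by
  have h (i : ι) : bitSign (x i) * bitSign (y i) = 1 - 2 * (if x i ≠ y i then 1 else 0) := by
    cases x i <;> cases y i <;> norm_num [bitSign]
  simp_rw [h]
  rw [sum_sub_distrib, ← mul_sum, sum_boole, hammingDist]
  simp

lemma bitWeight_le (z : ι → Bool) : bitWeight z ≤ Fintype.card ι := card_le_univ _

variable [DecidableEq ι]

lemma walsh_flipBit (i : ι) (z x : ι → Bool) :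
    walsh (flipBit i z) x = bitSign (x i) * walsh z x := by
  have hrest : ∏ j ∈ univ.erase i, (if flipBit i z j then bitSign (x j) else 1)
      = ∏ j ∈ univ.erase i, if z j then bitSign (x j) else 1 :=
    prod_congr rfl fun j hj => by simp [flipBit, ne_of_mem_erase hj]
  rw [walsh, walsh, ← mul_prod_erase univ _ (mem_univ i),
    ← mul_prod_erase univ (fun j => if z j then bitSign (x j) else 1) (mem_univ i), hrest,
    ← mul_assoc]
  congr 1
  cases h : z i <;> simp [flipBit, h, bitSign_mul_self]

/-- The linear programming bound for codes obtained from a nonnegative function `f` on the cube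
which satisfies `l • f ≤ A f`, where `A` is the adjacency operator of the cube. -/
theorem card_code_mul_le (C : Finset (ι → Bool)) (f : (ι → Bool) → ℝ) (hf : ∀ z, 0 ≤ f z)
    (c l : ℝ) (hl : ∀ z, l * f z ≤ ∑ i, f (flipBit i z)) (hcl : c ≤ l)
    (hC : ∀ x ∈ C, ∀ y ∈ C, x ≠ y → Fintype.card ι - 2 * (hammingDist x y : ℝ) ≤ c) :
    (l - c) * (#C : ℝ) ^ 2 * ∑ z, f z ^ 2 ≤ (Fintype.card ι - c) * #C * (∑ z, f z) ^ 2 := by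
  set E : (ι → Bool) → (ι → Bool) → ℝ := fun z w => (∑ x ∈ C, walsh z x * walsh w x) ^ 2 with hE
  set T : (ι → Bool) → (ι → Bool) → ℝ := fun x y => ∑ z, f z * (walsh z x * walsh z y) with hT
  set S : ℝ := ∑ x ∈ C, ∑ y ∈ C,
    (Fintype.card ι - 2 * (hammingDist x y : ℝ) - c) * T x y ^ 2 with hS
  have hupper : S ≤ (Fintype.card ι - c) * #C * (∑ z, f z) ^ 2 := by
    calc S ≤ ∑ x ∈ C, ∑ y ∈ C, if x = y then (Fintype.card ι - c) * (∑ z, f z) ^ 2 else 0 := by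
          refine sum_le_sum fun x hx => sum_le_sum fun y hy => ?_
          split_ifs with h
          · subst h
            simp [hT, walsh_mul_self]
          · exact mul_nonpos_of_nonpos_of_nonneg (by linarith [hC x hx y hy h]) (sq_nonneg _)
      _ = _ := by
          simp only [sum_ite_eq, sum_ite_mem, inter_self, sum_const, nsmul_eq_mul]
          ring
  have hexpand : S = ∑ w, f w * ∑ z, f z * (∑ i, E (flipBit i z) w - c * E z w) := by
    have hTsq (x y : ι → Bool) : T x y ^ 2 =
        ∑ w, ∑ z, f w * f z * (walsh z x * walsh w x * (walsh z y * walsh w y)) := by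
      rw [sq, hT, sum_mul_sum]
      refine sum_congr rfl fun w _ => sum_congr rfl fun z _ => by ring
    have hEz (z w : ι → Bool) : E z w =
        ∑ x ∈ C, ∑ y ∈ C, walsh z x * walsh w x * (walsh z y * walsh w y) := by
      simp only [hE]; rw [sq, sum_mul_sum]
    have hEi (z w : ι → Bool) : ∑ i, E (flipBit i z) w =
        ∑ x ∈ C, ∑ y ∈ C, (Fintype.card ι - 2 * (hammingDist x y : ℝ)) *
          (walsh z x * walsh w x * (walsh z y * walsh w y)) := by
      simp_rw [hEz, walsh_flipBit, ← sum_bitSign_mul, sum_mul]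
      rw [sum_comm]
      refine sum_congr rfl fun x _ => ?_
      rw [sum_comm]
      refine sum_congr rfl fun y _ => sum_congr rfl fun i _ => by ring
    simp_rw [hEi, hEz, hS, hTsq, mul_sum, ← sum_sub_distrib, mul_sum]
    have hswap (g : (ι → Bool) → (ι → Bool) → (ι → Bool) → ℝ) :
        ∑ x ∈ C, ∑ w, ∑ z, g x w z = ∑ w, ∑ z, ∑ x ∈ C, g x w z :=
      sum_comm.trans (sum_congr rfl fun w _ => sum_comm)
    rw [sum_congr rfl fun x _ => hswap _, hswap]
    refine sum_congr rfl fun w _ => sum_congr rfl fun z _ => sum_congr rfl fun x _ =>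
      sum_congr rfl fun y _ => by ring
  have hmove (w : ι → Bool) : ∑ z, f z * (∑ i, E (flipBit i z) w - c * E z w) =
      ∑ z, (∑ i, f (flipBit i z) - c * f z) * E z w := by
    simp_rw [mul_sub, sub_mul, sum_sub_distrib, mul_sum, sum_mul]
    congr 1
    · rw [sum_comm, sum_comm (s := univ) (t := univ) (f := fun z i => f (flipBit i z) * E z w)]
      refine sum_congr rfl fun i _ => ?_
      exact Fintype.sum_equiv ((flipBit_involutive i).toPerm) _ _
        fun z => by simp [flipBit_involutive i z]
    · exact sum_congr rfl fun z _ => by ring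
  have hlower : (l - c) * (#C : ℝ) ^ 2 * ∑ z, f z ^ 2 ≤ S := by
    rw [hexpand, mul_sum]
    refine sum_le_sum fun w _ => ?_
    rw [hmove]
    have hnn (z : ι → Bool) : (l - c) * f z * E z w ≤
        (∑ i, f (flipBit i z) - c * f z) * E z w :=
      mul_le_mul_of_nonneg_right (by linarith [hl z]) (sq_nonneg _)
    have hEw : E w w = (#C : ℝ) ^ 2 := by simp [hE, walsh_mul_self]
    calc (l - c) * (#C : ℝ) ^ 2 * f w ^ 2 = f w * ((l - c) * f w * E w w) := by rw [hEw]; ring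
      _ ≤ f w * ∑ z, (l - c) * f z * E z w :=
          mul_le_mul_of_nonneg_left (single_le_sum (f := fun z => (l - c) * f z * E z w)
            (fun z _ => mul_nonneg (mul_nonneg (sub_nonneg.2 hcl) (hf z)) (sq_nonneg _))
            (mem_univ w)) (hf w)
      _ ≤ _ := mul_le_mul_of_nonneg_left (sum_le_sum fun z _ => hnn z) (hf w)
  exact hlower.trans hupper

lemma bitWeight_flipBit_of_true {i : ι} {z : ι → Bool} (h : z i = true) :
    bitWeight (flipBit i z) = bitWeight z - 1 := by
  rw [bitWeight, bitWeight, ← card_erase_of_mem (a := i) (by simpa using h)]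
  congr 1
  ext j
  by_cases hj : j = i
  · subst hj; simp [flipBit, h]
  · have hji : flipBit i z j = z j := Function.update_of_ne hj _ _
    simp [hji, hj]

lemma bitWeight_flipBit_of_false {i : ι} {z : ι → Bool} (h : z i = false) :
    bitWeight (flipBit i z) = bitWeight z + 1 := by
  rw [bitWeight, bitWeight, ← card_insert_of_notMem (a := i) (by simpa using h)]
  congr 1
  ext j
  by_cases hj : j = i
  · subst hj; simp [flipBit, h]
  · have hji : flipBit i z j = z j := Function.update_of_ne hj _ _
    simp [hji, hj]

lemma sum_radial_flipBit (u : ℕ → ℝ) (z : ι → Bool) :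
    ∑ i, u (bitWeight (flipBit i z)) = bitWeight z * u (bitWeight z - 1) +
      (Fintype.card ι - bitWeight z) * u (bitWeight z + 1) := by
  have h (i : ι) : u (bitWeight (flipBit i z)) =
      if z i = true then u (bitWeight z - 1) else u (bitWeight z + 1) := by
    split_ifs with hi
    · rw [bitWeight_flipBit_of_true hi]
    · rw [bitWeight_flipBit_of_false (by simpa using hi)]
  have hc : (#{i | ¬ z i = true} : ℝ) = Fintype.card ι - bitWeight z := by
    have := card_filter_add_card_filter_not (s := (univ : Finset ι)) (fun i => z i = true)
    rw [eq_sub_iff_add_eq', bitWeight]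
    exact_mod_cast this
  simp_rw [h]
  rw [sum_ite, sum_const, sum_const, nsmul_eq_mul, nsmul_eq_mul, hc, bitWeight]

/-- The entropy bound for the volume of a Hamming ball. -/
lemma card_ball_mul_le {p : ℝ} (hp0 : 0 < p) (hp : p ≤ 1 / 2) :
    (#{z : ι → Bool | (bitWeight z : ℝ) ≤ p * Fintype.card ι} : ℝ) *
      (p ^ (p * Fintype.card ι) * (1 - p) ^ (Fintype.card ι - p * Fintype.card ι)) ≤ 1 := by
  set n := Fintype.card ι with hn
  have hq0 : 0 < 1 - p := by linarith
  have hmass : ∑ z : ι → Bool, ∏ i, (if z i = true then p else 1 - p) = 1 := by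
    rw [← Fintype.prod_sum (fun (_ : ι) (b : Bool) => if b = true then p else 1 - p)]
    simp
  rw [← nsmul_eq_mul, ← sum_const]
  refine le_trans (sum_le_sum fun z hz => ?_) ((sum_le_sum_of_subset_of_nonneg
    (subset_univ _) fun z _ _ => prod_nonneg fun i _ => ?_).trans_eq hmass)
  · have hk : (bitWeight z : ℝ) ≤ p * n := by simpa using hz
    rw [prod_ite, prod_const, prod_const]
    have hc : (#{i | ¬ z i = true} : ℝ) = n - bitWeight z := by
      have := card_filter_add_card_filter_not (s := (univ : Finset ι)) (fun i => z i = true)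
      rw [eq_sub_iff_add_eq', bitWeight]
      exact_mod_cast this
    change _ ≤ p ^ bitWeight z * _
    rw [← Real.rpow_natCast, ← Real.rpow_natCast, hc]
    have h1 : p ^ (p * n) = p ^ (bitWeight z : ℝ) * p ^ (p * n - bitWeight z) := by
      rw [← Real.rpow_add hp0]; congr 1; ring
    have h2 : (1 - p) ^ ((n : ℝ) - bitWeight z) =
        (1 - p) ^ (n - p * n) * (1 - p) ^ (p * n - bitWeight z) := by
      rw [← Real.rpow_add hq0]; congr 1; ring
    have h3 : p ^ (p * n - bitWeight z) ≤ (1 - p) ^ (p * n - bitWeight z) :=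
      Real.rpow_le_rpow hp0.le (by linarith) (by linarith)
    rw [h1, h2, mul_assoc, mul_comm (p ^ _) ((1 - p) ^ (n - p * n))]
    gcongr
  · split_ifs <;> linarith

end Cube

/-- A weighted parabola supported on the weights strictly between `a` and `a + M + 1`. -/
noncomputable def bump (a M : ℕ) (t : ℝ) (k : ℕ) : ℝ :=
  if a < k ∧ k < a + M + 1 then t ^ k * (((k : ℝ) - a) * (a + M + 1 - k)) else 0

lemma bump_nonneg (a M : ℕ) {t : ℝ} (ht : 0 < t) (k : ℕ) : 0 ≤ bump a M t k := by
  rw [bump]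
  split_ifs with h
  · have h1 : (a : ℝ) < k := by exact_mod_cast h.1
    have h2 : (k : ℝ) < a + M + 1 := by exact_mod_cast h.2
    exact mul_nonneg (by positivity) (mul_nonneg (by linarith) (by linarith))
  · exact le_rfl

lemma bump_eq {a M k : ℕ} (t : ℝ) (h1 : a ≤ k) (h2 : k ≤ a + M + 1) :
    bump a M t k = t ^ k * (((k : ℝ) - a) * (a + M + 1 - k)) := by
  rw [bump]
  split_ifs with h
  · rfl
  · obtain rfl | rfl : k = a ∨ k = a + M + 1 := by omega
    · simp
    · push_cast; simp

lemma mul_bump_le {n a M k : ℕ} {s t : ℝ} (hM : 1 ≤ M) (ht : 0 < t) (hs : 0 ≤ s)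
    (ha : s * t ≤ a) (hb : s ≤ t * (n - (a + M + 1))) (hk : k ≤ n) :
    2 * s * (1 - 1 / M) * bump a M t k ≤
      k * bump a M t (k - 1) + (n - k) * bump a M t (k + 1) := by
  have hkn : (k : ℝ) ≤ n := by exact_mod_cast hk
  by_cases h : a < k ∧ k < a + M + 1
  · obtain ⟨j, rfl⟩ : ∃ j, k = j + 1 := ⟨k - 1, by omega⟩
    have hM' : (0 : ℝ) < M := by exact_mod_cast hM
    rw [Nat.add_sub_cancel, bump_eq t h.1.le h.2.le, bump_eq t (by omega) (by omega),
      bump_eq t (by omega) (by omega)]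
    have h1 : (a : ℝ) ≤ j := by exact_mod_cast Nat.lt_succ_iff.1 h.1
    have h2 : (j : ℝ) + 1 ≤ a + M := by exact_mod_cast Nat.lt_succ_iff.1 h.2
    push_cast at hkn ⊢
    set d : ℝ := j - a with hd
    have hd0 : 0 ≤ d := by linarith
    have hdM : d + 1 ≤ M := by linarith
    have e1 : (j : ℝ) + 1 - a = d + 1 := by ring
    have e2 : (a : ℝ) + M + 1 - (j + 1) = M - d := by ring
    have e3 : (a : ℝ) + M + 1 - j = M - d + 1 := by ring
    have e4 : (j : ℝ) + 1 + 1 - a = d + 2 := by ring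
    have e5 : (a : ℝ) + M + 1 - (j + 1 + 1) = M - d - 1 := by ring
    rw [e1, e2, e3, e4, e5]
    have hw : (M : ℝ) ≤ (d + 1) * (M - d) := by nlinarith
    have hcore : (1 - 1 / (M : ℝ)) * ((d + 1) * (M - d)) ≤ (d + 1) * (M - d) - 1 := by
      have : 1 ≤ 1 / (M : ℝ) * ((d + 1) * (M - d)) := by
        rw [one_div, ← div_eq_inv_mul, le_div_iff₀ hM']; linarith
      linarith
    have hA : s * t * (d * (M - d + 1)) ≤ (j + 1) * (d * (M - d + 1)) :=
      mul_le_mul_of_nonneg_right (by linarith) (mul_nonneg hd0 (by linarith))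
    have hB : s * ((d + 2) * (M - d - 1)) ≤
        t * (n - (j + 1)) * ((d + 2) * (M - d - 1)) :=
      mul_le_mul_of_nonneg_right (hb.trans (mul_le_mul_of_nonneg_left (by linarith) ht.le))
        (mul_nonneg (by linarith) (by linarith))
    have hD := mul_le_mul_of_nonneg_left hcore (by positivity : 0 ≤ 2 * s)
    have hj : 0 < t ^ j := by positivity
    have hA' := mul_le_mul_of_nonneg_left hA hj.le
    have hB' := mul_le_mul_of_nonneg_left hB (by positivity : 0 ≤ t ^ (j + 1))
    have hD' := mul_le_mul_of_nonneg_left hD (by positivity : 0 ≤ t ^ (j + 1))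
    simp only [pow_succ] at hA' hB' hD' ⊢
    linarith
  · rw [bump, if_neg h, mul_zero]
    exact add_nonneg (mul_nonneg (by positivity) (bump_nonneg a M ht _))
      (mul_nonneg (by linarith) (bump_nonneg a M ht _))

lemma exists_bitWeight_eq {n k : ℕ} (hk : k ≤ n) : ∃ z : Fin n → Bool, bitWeight z = k := by
  obtain ⟨s, -, hs⟩ := exists_subset_card_eq (s := (univ : Finset (Fin n))) (n := k) (by simpa)
  exact ⟨fun i => decide (i ∈ s), by simp [bitWeight, hs]⟩

/-- A code of large minimum distance is at most a constant factor larger than a Hamming ball whose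
induced subgraph has large spectral radius. -/
lemma card_code_le_card_ball {n a M : ℕ} {s t c R : ℝ} (hM : 1 ≤ M) (ht : 0 < t) (hs : 0 ≤ s)
    (ha : s * t ≤ a) (hb : s ≤ t * (n - (a + M + 1))) (hR : (a : ℝ) + M ≤ R) (han : a + M ≤ n)
    (hcn : c ≤ n) (hc : c ≤ 2 * s * (1 - 1 / M)) (C : Finset (Fin n → Bool)) (hne : C.Nonempty)
    (hC : ∀ x ∈ C, ∀ y ∈ C, x ≠ y → n - 2 * (hammingDist x y : ℝ) ≤ c) :
    (2 * s * (1 - 1 / M) - c) * #C ≤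
      (n - c) * #{z : Fin n → Bool | (bitWeight z : ℝ) ≤ R} := by
  set f : (Fin n → Bool) → ℝ := fun z => bump a M t (bitWeight z) with hf
  set B : Finset (Fin n → Bool) := {z | (bitWeight z : ℝ) ≤ R} with hB
  have hzero : ∀ z ∉ B, f z = 0 := by
    intro z hz
    refine if_neg fun h => hz ?_
    have : (bitWeight z : ℝ) ≤ a + M := by exact_mod_cast Nat.lt_succ_iff.1 h.2
    simpa [hB] using this.trans hR
  have hpos : 0 < ∑ z, f z ^ 2 := by
    obtain ⟨z, hz⟩ := exists_bitWeight_eq han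
    refine sum_pos' (fun z _ => sq_nonneg _) ⟨z, mem_univ z, pow_pos ?_ 2⟩
    have hM' : (0 : ℝ) < M := by exact_mod_cast hM
    rw [hf]
    simp only [hz]
    rw [bump_eq t (by omega) (by omega)]
    push_cast
    have e1 : (a : ℝ) + M - a = M := by ring
    have e2 : (a : ℝ) + M + 1 - (a + M) = 1 := by ring
    rw [e1, e2]
    positivity
  have hCS : (∑ z, f z) ^ 2 ≤ #B * ∑ z, f z ^ 2 := by
    rw [← sum_subset (subset_univ B) fun z _ hz => hzero z hz]
    refine sq_sum_le_card_mul_sum_sq.trans (mul_le_mul_of_nonneg_left ?_ (by positivity))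
    exact sum_le_sum_of_subset_of_nonneg (subset_univ B) fun z _ _ => sq_nonneg _
  have hLP := card_code_mul_le C f (fun z => bump_nonneg a M ht _) c (2 * s * (1 - 1 / M))
    (fun z => by
      rw [sum_radial_flipBit (bump a M t), Fintype.card_fin]
      exact mul_bump_le hM ht hs ha hb (by simpa using bitWeight_le z)) hc (by simpa using hC)
  rw [Fintype.card_fin] at hLP
  have hCpos : (0 : ℝ) < #C := by exact_mod_cast hne.card_pos
  have h2 := mul_le_mul_of_nonneg_left hCS
    (mul_nonneg (sub_nonneg.2 hcn) hCpos.le)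
  refine le_of_mul_le_mul_right ?_ (mul_pos hCpos hpos)
  linarith

lemma binEnt_eq (x : ℝ) : binEnt x = Real.binEntropy x / Real.log 2 := by
  simp only [binEnt, Real.binEntropy, Real.logb, Real.log_inv]
  ring

lemma continuous_binEnt : Continuous binEnt := by
  rw [funext binEnt_eq]
  fun_prop

lemma logb_card_ball_le {n : ℕ} {p : ℝ} (hp0 : 0 < p) (hp : p ≤ 1 / 2) :
    Real.logb 2 #{z : Fin n → Bool | (bitWeight z : ℝ) ≤ p * n} ≤ n * binEnt p := by
  have h := card_ball_mul_le (ι := Fin n) hp0 hp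
  rw [Fintype.card_fin] at h
  have hq0 : 0 < 1 - p := by linarith
  have hcard : (0 : ℝ) < #{z : Fin n → Bool | (bitWeight z : ℝ) ≤ p * n} := by
    have : (fun _ => false) ∈ ({z : Fin n → Bool | (bitWeight z : ℝ) ≤ p * n} : Finset _) := by
      refine (mem_filter_univ _).2 ?_
      simpa [bitWeight] using mul_nonneg hp0.le n.cast_nonneg
    exact_mod_cast card_pos.2 ⟨_, this⟩
  have h1 : 0 < p ^ (p * n) := by positivity
  have h2 : 0 < (1 - p) ^ (n - p * n) := by positivity
  have hlog := Real.logb_le_logb_of_le one_lt_two (by positivity) h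
  rw [Real.logb_one, Real.logb_mul hcard.ne' (by positivity), Real.logb_mul h1.ne' h2.ne',
    Real.logb_rpow_eq_mul_logb_of_pos hp0, Real.logb_rpow_eq_mul_logb_of_pos hq0] at hlog
  rw [binEnt]
  linarith

lemma exists_radius {δ ε : ℝ} (hδ0 : 0 < δ) (hδ : δ < 1 / 2) (hε : 0 < ε) :
    ∃ p, 0 < p ∧ p < 1 / 2 ∧ 1 / 2 - δ < √(p * (1 - p)) ∧
      binEnt p < binEnt (1 / 2 - √(δ * (1 - δ))) + ε := by
  set r := √(δ * (1 - δ)) with hr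
  have hrsq : r ^ 2 = δ * (1 - δ) := Real.sq_sqrt (by nlinarith)
  have hr0 : 0 < r := Real.sqrt_pos.2 (by nlinarith)
  have hr1 : r < 1 / 2 := by nlinarith
  have h1 : ∀ᶠ p in nhdsWithin (1 / 2 - r) (Set.Ioi (1 / 2 - r)),
      binEnt p < binEnt (1 / 2 - r) + ε :=
    (continuous_binEnt.continuousAt.eventually_lt continuousAt_const
      (by linarith)).filter_mono nhdsWithin_le_nhds
  have h2 : ∀ᶠ p in nhdsWithin (1 / 2 - r) (Set.Ioi (1 / 2 - r)),
      p ∈ Set.Ioo (1 / 2 - r) (1 / 2) := Ioo_mem_nhdsGT (by linarith)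
  obtain ⟨p, hent, hρp, hp⟩ := (h1.and h2).exists
  exact ⟨p, by linarith, hp, Real.lt_sqrt_of_sq_lt (by nlinarith), hent⟩

/-- A code of relative distance `δ` is at most a constant factor larger than a Hamming ball of
relative radius `p`, provided that `1 - 2 * δ < 2 * √(p * (1 - p))`. -/
lemma exists_card_code_le {δ p : ℝ} (hδ0 : 0 < δ) (hδ : δ < 1 / 2) (hp0 : 0 < p) (hp : p < 1 / 2)
    (hδp : 1 / 2 - δ < √(p * (1 - p))) :
    ∃ K : ℝ, 0 < K ∧ ∃ N : ℕ, ∀ n : ℕ, N ≤ n → ∀ C : Finset (Fin n → Bool), C.Nonempty →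
      (∀ x ∈ C, ∀ y ∈ C, x ≠ y → δ * n ≤ hammingDist x y) →
      (#C : ℝ) ≤ K * #{z : Fin n → Bool | (bitWeight z : ℝ) ≤ p * n} := by
  have hq0 : 0 < 1 - p := by linarith
  set q := √(p * (1 - p)) with hq
  have hqsq : q ^ 2 = p * (1 - p) := Real.sq_sqrt (by positivity)
  have hqpos : 0 < q := Real.sqrt_pos.2 (by positivity)
  obtain ⟨t, ht0, hqt, htq⟩ : ∃ t, 0 < t ∧ q * t = p ∧ t * (1 - p) = q :=
    ⟨q / (1 - p), by positivity, by field_simp; linarith, by field_simp⟩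
  obtain ⟨σ, hσ1, hσ2⟩ := exists_between hδp
  have hσ0 : 0 < σ := by linarith
  obtain ⟨M, hMσ⟩ := exists_nat_gt (σ / (σ - (1 / 2 - δ)))
  have hM0 : (0 : ℝ) < M := lt_of_le_of_lt (div_nonneg hσ0.le (by linarith)) hMσ
  have hM1 : 1 ≤ M := by exact_mod_cast hM0
  obtain ⟨η, hη⟩ : ∃ η, η = 2 * σ * (1 - 1 / M) - (1 - 2 * δ) := ⟨_, rfl⟩
  have hη0 : 0 < η := by
    rw [div_lt_iff₀ (by linarith)] at hMσ
    have : σ / M < σ - (1 / 2 - δ) := by rw [div_lt_iff₀ hM0]; linarith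
    have e : η = 2 * (σ - σ / M) - (1 - 2 * δ) := by rw [hη]; ring
    linarith
  have hst : σ * t < p := by rw [← hqt]; gcongr
  obtain ⟨N₁, hN₁⟩ := exists_nat_gt ((M + 1) / (p - σ * t))
  obtain ⟨N₂, hN₂⟩ := exists_nat_gt (t / (q - σ))
  refine ⟨2 * δ / η, by positivity, N₁ + N₂, fun n hn C hne hC => ?_⟩
  have hn' : (N₁ + N₂ : ℝ) ≤ n := by exact_mod_cast hn
  have hN₁0 : (0 : ℝ) ≤ N₁ := by positivity
  have hN₂0 : (0 : ℝ) < N₂ := (div_pos ht0 (by linarith)).trans hN₂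
  have hn0 : (0 : ℝ) < n := by linarith
  have hb1 : (M + 1 : ℝ) ≤ n * (p - σ * t) :=
    ((div_lt_iff₀ (by linarith)).1 (hN₁.trans_le (by linarith))).le
  have hb2 : t ≤ n * (q - σ) :=
    ((div_lt_iff₀ (by linarith)).1 (hN₂.trans_le (by linarith))).le
  have hfl1 : (⌊p * n⌋₊ : ℝ) ≤ p * n := Nat.floor_le (by positivity)
  have hfl2 : p * n < ⌊p * n⌋₊ + 1 := Nat.lt_floor_add_one _
  have hσtn : 0 < σ * t * n := by positivity
  obtain ⟨a, ha⟩ : ∃ a, ⌊p * n⌋₊ = a + M := by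
    refine ⟨⌊p * n⌋₊ - M, (Nat.sub_add_cancel ?_).symm⟩
    have : (M : ℝ) ≤ ⌊p * n⌋₊ := by linarith
    exact_mod_cast this
  rw [ha] at hfl1 hfl2
  push_cast at hfl1 hfl2
  have hsa : σ * n * t ≤ a := by linarith
  have hsb : σ * n ≤ t * (n - (a + M + 1)) := by
    have : t * ((1 - p) * n - 1) ≤ t * (n - (a + M + 1)) :=
      mul_le_mul_of_nonneg_left (by linarith) ht0.le
    have e : t * ((1 - p) * n - 1) = q * n - t := by rw [← htq]; ring
    linarith
  have han : a + M ≤ n := by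
    have : (a + M : ℝ) ≤ n := hfl1.trans (mul_le_of_le_one_left hn0.le (by linarith))
    exact_mod_cast this
  have hgap : 2 * (σ * n) * (1 - 1 / M) - (1 - 2 * δ) * n = η * n := by rw [hη]; ring
  have hηn : 0 < η * n := mul_pos hη0 hn0
  have hcard := card_code_le_card_ball hM1 ht0 (by positivity) hsa hsb hfl1 han
    (c := (1 - 2 * δ) * n) (by linarith [mul_pos hδ0 hn0]) (by linarith) C hne
    (fun x hx y hy hxy => by linarith [hC x hx y hy hxy])
  rw [hgap] at hcard
  rw [div_mul_eq_mul_div, le_div_iff₀ hη0]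
  refine le_of_mul_le_mul_right ?_ hn0
  linarith

/-- The asymptotic MRRW (first linear programming) bound for binary codes. -/
theorem mrrw_bound_binary (δ ε : ℝ) (hδ0 : 0 < δ) (hδ : δ < 1 / 2) (hε : 0 < ε) :
    ∃ N : ℕ, ∀ n : ℕ, N ≤ n → ∀ C : Finset (Fin n → Bool),
      (∀ x ∈ C, ∀ y ∈ C, x ≠ y → δ * n ≤ hammingDist x y) →
      (1 / (n : ℝ)) * Real.logb 2 C.card
        ≤ binEnt (1 / 2 - Real.sqrt (δ * (1 - δ))) + ε := by
  obtain ⟨p, hp0, hp, hδp, hent⟩ := exists_radius hδ0 hδ (half_pos hε)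
  obtain ⟨K, hK, N₁, hN₁⟩ := exists_card_code_le hδ0 hδ hp0 hp hδp
  obtain ⟨N₂, hN₂⟩ := exists_nat_gt (Real.logb 2 K / (ε / 2))
  refine ⟨N₁ + N₂ + 1, fun n hn => ?_⟩
  have hn0 : (0 : ℝ) < n := by exact_mod_cast (by omega : 0 < n)
  have hN₂n : (N₂ : ℝ) ≤ n := by exact_mod_cast (by omega : N₂ ≤ n)
  have hKn : Real.logb 2 K ≤ n * (ε / 2) :=
    ((div_lt_iff₀ (half_pos hε)).1 (hN₂.trans_le hN₂n)).le
  have hnonempty (C : Finset (Fin n → Bool)) (hne : C.Nonempty)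
      (hC : ∀ x ∈ C, ∀ y ∈ C, x ≠ y → δ * n ≤ hammingDist x y) :
      (1 / (n : ℝ)) * Real.logb 2 C.card ≤ binEnt (1 / 2 - √(δ * (1 - δ))) + ε := by
    have hle := hN₁ n (by omega) C hne hC
    have hball := logb_card_ball_le (n := n) hp0 hp.le
    have hCpos : (0 : ℝ) < #C := by exact_mod_cast hne.card_pos
    have hBpos := pos_of_mul_pos_right (hCpos.trans_le hle) hK.le
    have hlog := Real.logb_le_logb_of_le one_lt_two hCpos hle
    rw [Real.logb_mul hK.ne' hBpos.ne'] at hlog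
    rw [one_div, ← div_eq_inv_mul, div_le_iff₀ hn0]
    have := mul_le_mul_of_nonneg_left hent.le hn0.le
    linarith
  intro C hC
  rcases C.eq_empty_or_nonempty with rfl | hne
  · simpa using hnonempty {fun _ => false} (singleton_nonempty _) (by simp)
  · exact hnonempty C hne hC
end

section
/- Let n ≥ 1 and 0 ≤ k < n. Let K_{k+1}(x) = ∑_{j=0}^{k+1} (−1)^j · C(x,j) · C(n−x, k+1−j) be the Krawtchouk polynomial, where C(x,j) = x(x−1)⋯(x−j+1)/j! is the generalized binomial coefficient (so K_{k+1} is a real polynomial of degree k+1). Then the largest real root of K_{k+1} equals n/2 + max over unit vectors y = (y_0,…,y_k) ∈ ℝ^{k+1} of ∑_{i=0}^{k−1} y_i y_{i+1} √((i+1)(n−i)). -/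
/-- The generalized binomial coefficient `C(x, j) = x(x−1)⋯(x−j+1)/j!` for real `x`. -/
noncomputable def genChoose (x : ℝ) (j : ℕ) : ℝ :=
  (∏ i ∈ Finset.range j, (x - i)) / (Nat.factorial j)

/-- The Krawtchouk polynomial `K_k` of the binary Hamming space of length `n`,
as a real function of a real variable. -/
noncomputable def krawtchoukR (n k : ℕ) (x : ℝ) : ℝ :=
  ∑ j ∈ Finset.range (k + 1), (-1 : ℝ) ^ j * genChoose x j * genChoose ((n : ℝ) - x) (k - j)

open Finset

section Recurrence

lemma genChoose_succ (x : ℝ) (j : ℕ) :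
    ((j : ℝ) + 1) * genChoose x (j + 1) = (x - j) * genChoose x j := by
  have h : (Nat.factorial j : ℝ) ≠ 0 := by positivity
  have h' : (j : ℝ) + 1 ≠ 0 := by positivity
  simp only [genChoose, prod_range_succ, Nat.factorial_succ]
  push_cast
  field_simp

/-- The generating function of the Krawtchouk polynomials is the product of the binomial series
`(1 - z)^x` and `(1 + z)^(n - x)`. -/
lemma krawtchoukR_eq_coeff (n k : ℕ) (x : ℝ) :
    krawtchoukR n k x = PowerSeries.coeff k
      (PowerSeries.mk (fun j => (-1 : ℝ) ^ j * genChoose x j) *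
        PowerSeries.mk (fun j => genChoose ((n : ℝ) - x) j)) := by
  rw [PowerSeries.coeff_mul, Finset.Nat.sum_antidiagonal_eq_sum_range_succ_mk]
  simp [krawtchoukR]

lemma krawtchoukR_generating_ode (n : ℕ) (x : ℝ) :
    let F := PowerSeries.mk (fun j => (-1 : ℝ) ^ j * genChoose x j) *
      PowerSeries.mk (fun j => genChoose ((n : ℝ) - x) j)
    PowerSeries.derivative ℝ F + PowerSeries.C (n : ℝ) * (PowerSeries.X * F) =
      PowerSeries.C ((n : ℝ) - 2 * x) * F +
        PowerSeries.X * (PowerSeries.X * PowerSeries.derivative ℝ F) := by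
  intro F
  set G := PowerSeries.mk (fun j => (-1 : ℝ) ^ j * genChoose x j) with hG
  set H := PowerSeries.mk (fun j => genChoose ((n : ℝ) - x) j) with hH
  have h1 : PowerSeries.derivative ℝ G =
      PowerSeries.X * PowerSeries.derivative ℝ G - PowerSeries.C x * G := by
    ext j
    cases j with
    | zero =>
      have := genChoose_succ x 0
      simp [hG, PowerSeries.coeff_derivative] at this ⊢
      linarith
    | succ j =>
      have := genChoose_succ x (j + 1)
      simp [hG, PowerSeries.coeff_derivative, PowerSeries.coeff_succ_X_mul] at this ⊢
      linear_combination (-1 : ℝ) ^ j * this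
  have h2 : PowerSeries.derivative ℝ H =
      PowerSeries.C ((n : ℝ) - x) * H - PowerSeries.X * PowerSeries.derivative ℝ H := by
    rw [hH]
    generalize (n : ℝ) - x = a
    ext j
    cases j with
    | zero =>
      have := genChoose_succ a 0
      simp [PowerSeries.coeff_derivative] at this ⊢
      linarith
    | succ j =>
      have := genChoose_succ a (j + 1)
      simp [PowerSeries.coeff_derivative, PowerSeries.coeff_succ_X_mul] at this ⊢
      linear_combination this
  have hF : PowerSeries.derivative ℝ F =
      G * PowerSeries.derivative ℝ H + H * PowerSeries.derivative ℝ G := by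
    simp only [F, G, H, Derivation.leibniz, smul_eq_mul]
  rw [hF]
  simp only [F, map_sub, map_mul, map_ofNat] at *
  linear_combination (1 - PowerSeries.X) * G * h2 + (1 + PowerSeries.X) * H * h1

lemma krawtchoukR_zero (n : ℕ) (x : ℝ) : krawtchoukR n 0 x = 1 := by
  simp [krawtchoukR, genChoose]

lemma krawtchoukR_one (n : ℕ) (x : ℝ) : krawtchoukR n 1 x = n - 2 * x := by
  simp [krawtchoukR, genChoose, sum_range_succ]
  ring

/-- The three-term recurrence of the Krawtchouk polynomials. -/
lemma krawtchoukR_add_two (n j : ℕ) (x : ℝ) :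
    ((j : ℝ) + 2) * krawtchoukR n (j + 2) x =
      ((n : ℝ) - 2 * x) * krawtchoukR n (j + 1) x - ((n : ℝ) - j) * krawtchoukR n j x := by
  have h := congrArg (PowerSeries.coeff (j + 1)) (krawtchoukR_generating_ode n x)
  simp only [map_add, PowerSeries.coeff_C_mul, PowerSeries.coeff_succ_X_mul,
    PowerSeries.coeff_derivative, ← krawtchoukR_eq_coeff] at h
  cases j with
  | zero =>
    simp [PowerSeries.coeff_zero_eq_constantCoeff] at h ⊢
    linear_combination h
  | succ j =>
    simp only [PowerSeries.coeff_succ_X_mul, PowerSeries.coeff_derivative,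
      ← krawtchoukR_eq_coeff] at h
    push_cast at h ⊢
    linear_combination h

end Recurrence

section Jacobi

variable (b : ℕ → ℝ) (k : ℕ)

/-- Half the quadratic form of the Jacobi matrix with zero diagonal and off-diagonal `b`. -/
def jacobiForm (y : ℕ → ℝ) : ℝ := ∑ i ∈ range k, y i * y (i + 1) * b i

lemma exists_isGreatest_jacobiForm :
    ∃ m, IsGreatest {r : ℝ | ∃ y : ℕ → ℝ, ∑ i ∈ range (k + 1), (y i) ^ 2 = 1 ∧
      r = jacobiForm b k y} m := by
  have hc : IsCompact ({y : ℕ → ℝ | ∀ i, y i ∈ Set.Icc (-1 : ℝ) 1} ∩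
      {y : ℕ → ℝ | ∑ i ∈ range (k + 1), (y i) ^ 2 = 1}) := by
    refine (isCompact_pi_infinite fun _ => isCompact_Icc).inter_right ?_
    exact isClosed_eq (by fun_prop) continuous_const
  have hne : ({y : ℕ → ℝ | ∀ i, y i ∈ Set.Icc (-1 : ℝ) 1} ∩
      {y : ℕ → ℝ | ∑ i ∈ range (k + 1), (y i) ^ 2 = 1}).Nonempty := by
    refine ⟨fun i => if i = 0 then 1 else 0, fun i => ?_, ?_⟩
    · by_cases h : i = 0 <;> simp [h]
    · simp
  obtain ⟨y, hy, hmax⟩ := hc.exists_isMaxOn hne (f := jacobiForm b k)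
    (by unfold jacobiForm; fun_prop)
  refine ⟨jacobiForm b k y, ⟨y, hy.2, rfl⟩, ?_⟩
  rintro _ ⟨z, hz, rfl⟩
  let w : ℕ → ℝ := fun i => if i < k + 1 then z i else 0
  have hw : ∀ i < k + 1, w i = z i := fun i hi => if_pos hi
  have hsum : ∑ i ∈ range (k + 1), (w i) ^ 2 = 1 := by
    rw [← hz]
    exact sum_congr rfl fun i hi => by rw [hw i (mem_range.1 hi)]
  have hform : jacobiForm b k w = jacobiForm b k z := by
    refine sum_congr rfl fun i hi => ?_
    have := mem_range.1 hi
    rw [hw i (by omega), hw (i + 1) (by omega)]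
  rw [← hform]
  refine hmax ⟨fun i => ?_, hsum⟩
  by_cases hi : i < k + 1
  · have : (w i) ^ 2 ≤ 1 := by
      rw [← hsum]
      exact single_le_sum (f := fun i => (w i) ^ 2) (fun _ _ => sq_nonneg _) (mem_range.2 hi)
    exact abs_le.1 ((sq_le_one_iff_abs_le_one _).1 this)
  · simp only [w, if_neg hi]
    norm_num

variable {b k} {m : ℝ}

lemma jacobiForm_le
    (hm : ∀ y : ℕ → ℝ, ∑ i ∈ range (k + 1), (y i) ^ 2 = 1 → jacobiForm b k y ≤ m) (z : ℕ → ℝ) :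
    jacobiForm b k z ≤ m * ∑ i ∈ range (k + 1), (z i) ^ 2 := by
  set S := ∑ i ∈ range (k + 1), (z i) ^ 2 with hS
  have hS0 : 0 ≤ S := sum_nonneg fun _ _ => sq_nonneg _
  rcases hS0.eq_or_lt with h0 | hpos
  · have hz : ∀ i ∈ range (k + 1), (z i) ^ 2 = 0 :=
      (sum_eq_zero_iff_of_nonneg fun _ _ => sq_nonneg _).1 h0.symm
    have : jacobiForm b k z = 0 := sum_eq_zero fun i hi => by
      have hi' := mem_range.1 hi
      rw [pow_eq_zero_iff (two_ne_zero) |>.1 (hz i (mem_range.2 (by omega)))]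
      ring
    rw [this, ← h0, mul_zero]
  · have hsq : Real.sqrt S ^ 2 = S := Real.sq_sqrt hS0
    have hinv : ((Real.sqrt S)⁻¹) ^ 2 = S⁻¹ := by rw [inv_pow, hsq]
    have h := hm (fun i => (Real.sqrt S)⁻¹ * z i) (by
      simp only [mul_pow, ← mul_sum, hinv, ← hS]
      exact inv_mul_cancel₀ hpos.ne')
    have hform : jacobiForm b k (fun i => (Real.sqrt S)⁻¹ * z i) = S⁻¹ * jacobiForm b k z := by
      rw [← hinv, jacobiForm, jacobiForm, mul_sum]
      exact sum_congr rfl fun i _ => by ring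
    rw [hform, inv_mul_le_iff₀ hpos] at h
    linarith

/-- The first-order condition satisfied by a maximizer, tested against `z`. -/
lemma jacobiForm_critical {y : ℕ → ℝ}
    (hm : ∀ z : ℕ → ℝ, jacobiForm b k z ≤ m * ∑ i ∈ range (k + 1), (z i) ^ 2)
    (hy : jacobiForm b k y = m * ∑ i ∈ range (k + 1), (y i) ^ 2) (z : ℕ → ℝ) :
    ∑ i ∈ range k, (y i * z (i + 1) + z i * y (i + 1)) * b i =
      2 * m * ∑ i ∈ range (k + 1), y i * z i := by
  set B := ∑ i ∈ range k, (y i * z (i + 1) + z i * y (i + 1)) * b i with hB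
  set P := ∑ i ∈ range (k + 1), y i * z i with hP
  set d := m * ∑ i ∈ range (k + 1), (z i) ^ 2 - jacobiForm b k z with hd
  have key : ∀ t : ℝ, 0 ≤ t * (2 * m * P - B) + t ^ 2 * d := by
    intro t
    have h := hm (fun i => y i + t * z i)
    have h1 : jacobiForm b k (fun i => y i + t * z i) =
        jacobiForm b k y + t * B + t ^ 2 * jacobiForm b k z := by
      simp only [jacobiForm, hB, mul_sum, ← sum_add_distrib]
      exact sum_congr rfl fun i _ => by ring
    have h2 : ∑ i ∈ range (k + 1), (y i + t * z i) ^ 2 =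
        ∑ i ∈ range (k + 1), (y i) ^ 2 + 2 * t * P + t ^ 2 * ∑ i ∈ range (k + 1), (z i) ^ 2 := by
      simp only [hP, mul_sum, ← sum_add_distrib]
      exact sum_congr rfl fun i _ => by ring
    rw [h1, h2, hy] at h
    rw [hd]
    linarith
  have hdisc := discrim_le_zero (a := d) (b := 2 * m * P - B) (c := 0)
    (fun t => by linarith [key t, sq t])
  have : (2 * m * P - B) ^ 2 ≤ 0 := by simpa [discrim] using hdisc
  have := pow_eq_zero_iff (two_ne_zero) |>.1 (le_antisymm this (sq_nonneg _))
  linarith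

/-- Solutions of the three-term recurrence truncated at level `k`. -/
lemma jacobiForm_of_recurrence {p : ℕ → ℝ} {l : ℝ} (h0 : b 0 * p 1 = 2 * l * p 0)
    (h : ∀ j < k, b (j + 1) * p (j + 2) = 2 * l * p (j + 1) - b j * p j) :
    2 * jacobiForm b k p + b k * p k * p (k + 1) = 2 * l * ∑ i ∈ range (k + 1), (p i) ^ 2 := by
  induction k with
  | zero => simp [jacobiForm]; linear_combination p 0 * h0
  | succ k ih =>
    have ih := ih fun j hj => h j (by omega)
    have hk := h k (by omega)
    rw [jacobiForm, sum_range_succ _ k, ← jacobiForm, sum_range_succ _ (k + 1)]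
    linear_combination ih + p (k + 1) * hk

/-- A maximizer of the form is proportional to the solution of the recurrence, which therefore
vanishes at level `k + 1`. -/
lemma recurrence_eq_zero_of_maximizer {p y : ℕ → ℝ} (hb : ∀ i ≤ k, 0 < b i) (hp : p 0 = 1)
    (h0 : b 0 * p 1 = 2 * m * p 0)
    (h : ∀ j < k, b (j + 1) * p (j + 2) = 2 * m * p (j + 1) - b j * p j)
    (hm : ∀ z : ℕ → ℝ, jacobiForm b k z ≤ m * ∑ i ∈ range (k + 1), (z i) ^ 2)
    (hy : jacobiForm b k y = m) (hy1 : ∑ i ∈ range (k + 1), (y i) ^ 2 = 1) :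
    p (k + 1) = 0 := by
  have crit := jacobiForm_critical hm (by rw [hy, hy1, mul_one])
  have hprop : ∀ j, j ≤ k → y j = y 0 * p j := by
    intro j
    induction j using Nat.strong_induction_on with
    | _ j ih =>
      intro hj
      match j, ih, hj with
      | 0, _, _ => rw [hp, mul_one]
      | 1, _, hj =>
        have hc := crit (fun i => if i = 0 then 1 else 0)
        have hk0 : 0 < k := hj
        simp [hk0] at hc
        have := hb 0 (by omega)
        apply mul_left_cancel₀ this.ne'
        rw [hp] at h0
        linear_combination hc - y 0 * h0
      | j + 2, ih, hj =>
        have hc := crit (fun i => if i = j + 1 then 1 else 0)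
        have h1 : j < k := by omega
        have h2 : j + 1 < k := by omega
        simp [add_mul, sum_add_distrib, h1, h2] at hc
        have := hb (j + 1) (by omega)
        apply mul_left_cancel₀ this.ne'
        rw [ih j (by omega) (by omega), ih (j + 1) (by omega) (by omega)] at hc
        linear_combination hc - y 0 * h j h1
  have hy0 : y 0 ≠ 0 := by
    intro hy0
    have : ∑ i ∈ range (k + 1), (y i) ^ 2 = 0 := sum_eq_zero fun i hi => by
      rw [hprop i (by have := mem_range.1 hi; omega), hy0]
      ring
    rw [this] at hy1
    exact zero_ne_one hy1
  have hbk := (hb k le_rfl).ne'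
  suffices y 0 * (b k * p (k + 1)) = 0 by simpa [hy0, hbk] using this
  have hc := crit (fun i => if i = k then 1 else 0)
  cases k with
  | zero =>
    simp at hc
    rw [h0, hp]
    rcases hc with hc | hc <;> simp [hc]
  | succ j =>
    simp [add_mul, sum_add_distrib] at hc
    rw [h j (by omega)]
    rw [hprop j (by omega), hprop (j + 1) (by omega)] at hc
    linear_combination -hc

end Jacobi

section Normalized

/-- The off-diagonal entries of the Jacobi matrix of the Krawtchouk polynomials. -/
noncomputable def krawtchoukJacobi (n i : ℕ) : ℝ :=
  Real.sqrt (((i : ℝ) + 1) * ((n : ℝ) - i))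

/-- Orthonormal Krawtchouk polynomials with positive leading coefficients. -/
noncomputable def krawtchoukOrthonormal (n : ℕ) (x : ℝ) (j : ℕ) : ℝ :=
  (-1) ^ j * krawtchoukR n j x / Real.sqrt (n.choose j)

lemma krawtchoukJacobi_pos {n i : ℕ} (hi : i < n) : 0 < krawtchoukJacobi n i := by
  have : (i : ℝ) < n := by exact_mod_cast hi
  exact Real.sqrt_pos.2 (mul_pos (by positivity) (by linarith))

lemma sqrt_choose_pos {n i : ℕ} (hi : i ≤ n) : 0 < Real.sqrt (n.choose i) :=
  Real.sqrt_pos.2 (by exact_mod_cast Nat.choose_pos hi)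

lemma choose_succ_mul_cast {n i : ℕ} (hi : i ≤ n) :
    (n.choose (i + 1) : ℝ) * (i + 1) = n.choose i * ((n : ℝ) - i) := by
  rw [← Nat.cast_sub hi]
  exact_mod_cast Nat.choose_succ_right_eq n i

lemma krawtchoukJacobi_mul_sqrt_choose {n i : ℕ} (hi : i < n) :
    krawtchoukJacobi n i * Real.sqrt (n.choose i) = (i + 1) * Real.sqrt (n.choose (i + 1)) := by
  have hin : (i : ℝ) < n := by exact_mod_cast hi
  have h1 : (0 : ℝ) ≤ i + 1 := by positivity
  rw [krawtchoukJacobi, ← Real.sqrt_mul (mul_nonneg h1 (by linarith)),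
    show ((i : ℝ) + 1) * (n - i) * n.choose i = (i + 1) ^ 2 * n.choose (i + 1) by
      linear_combination -((i : ℝ) + 1) * choose_succ_mul_cast hi.le,
    Real.sqrt_mul (sq_nonneg _), Real.sqrt_sq h1]

lemma krawtchoukJacobi_mul_sqrt_choose_succ {n i : ℕ} (hi : i < n) :
    krawtchoukJacobi n i * Real.sqrt (n.choose (i + 1)) = (n - i) * Real.sqrt (n.choose i) := by
  have hin : (i : ℝ) < n := by exact_mod_cast hi
  have h1 : (0 : ℝ) ≤ n - i := by linarith
  rw [krawtchoukJacobi, ← Real.sqrt_mul (mul_nonneg (by positivity) h1),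
    show ((i : ℝ) + 1) * (n - i) * n.choose (i + 1) = (n - i) ^ 2 * n.choose i by
      linear_combination ((n : ℝ) - i) * choose_succ_mul_cast hi.le,
    Real.sqrt_mul (sq_nonneg _), Real.sqrt_sq h1]

lemma krawtchoukOrthonormal_zero (n : ℕ) (x : ℝ) : krawtchoukOrthonormal n x 0 = 1 := by
  simp [krawtchoukOrthonormal, krawtchoukR_zero]

lemma krawtchoukOrthonormal_one {n : ℕ} (hn : 0 < n) (x : ℝ) :
    krawtchoukJacobi n 0 * krawtchoukOrthonormal n x 1 =
      2 * (x - n / 2) * krawtchoukOrthonormal n x 0 := by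
  have h : Real.sqrt n ≠ 0 := by positivity
  rw [krawtchoukOrthonormal_zero]
  simp [krawtchoukOrthonormal, krawtchoukJacobi, krawtchoukR_one]
  field_simp

lemma krawtchoukOrthonormal_add_two {n j : ℕ} (hj : j + 1 < n) (x : ℝ) :
    krawtchoukJacobi n (j + 1) * krawtchoukOrthonormal n x (j + 2) =
      2 * (x - n / 2) * krawtchoukOrthonormal n x (j + 1) -
        krawtchoukJacobi n j * krawtchoukOrthonormal n x j := by
  have s0 := (sqrt_choose_pos (n := n) (i := j) (by omega)).ne'
  have s1 := (sqrt_choose_pos (n := n) (i := j + 1) (by omega)).ne'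
  have s2 := (sqrt_choose_pos (n := n) (i := j + 2) (by omega)).ne'
  have e1 := krawtchoukJacobi_mul_sqrt_choose hj
  have e0 := krawtchoukJacobi_mul_sqrt_choose_succ (n := n) (i := j) (by omega)
  have hrec := krawtchoukR_add_two n j x
  rw [← eq_div_iff s1] at e1
  rw [← eq_div_iff s1] at e0
  rw [e0, e1]
  simp only [krawtchoukOrthonormal]
  push_cast
  field_simp
  linear_combination (-1 : ℝ) ^ j * hrec

lemma krawtchoukOrthonormal_eq_zero_iff {n j : ℕ} (hj : j ≤ n) (x : ℝ) :
    krawtchoukOrthonormal n x j = 0 ↔ krawtchoukR n j x = 0 := by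
  simp [krawtchoukOrthonormal, (sqrt_choose_pos hj).ne']

end Normalized

/-- The largest real root of the Krawtchouk polynomial `K_{k+1}` equals
`n/2 + max_{‖y‖=1} ∑_{i=0}^{k-1} y_i y_{i+1} √((i+1)(n−i))`. -/
theorem krawtchouk_largest_root (n k : ℕ) (hn : 1 ≤ n) (hk : k < n) :
    ∃ m : ℝ,
      IsGreatest {r : ℝ | ∃ y : ℕ → ℝ, ∑ i ∈ Finset.range (k + 1), (y i) ^ 2 = 1 ∧
          r = ∑ i ∈ Finset.range k, y i * y (i + 1) * Real.sqrt (((i : ℝ) + 1) * ((n : ℝ) - i))} m ∧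
      IsGreatest {x : ℝ | krawtchoukR n (k + 1) x = 0} ((n : ℝ) / 2 + m) := by
  obtain ⟨m, hm⟩ := exists_isGreatest_jacobiForm (krawtchoukJacobi n) k
  refine ⟨m, hm, ?_⟩
  have hle := jacobiForm_le fun y hy => hm.2 ⟨y, hy, rfl⟩
  constructor
  · obtain ⟨y, hy1, hy⟩ := hm.1
    rw [Set.mem_ofPred_eq, ← krawtchoukOrthonormal_eq_zero_iff hk]
    have hx : (n : ℝ) / 2 + m - n / 2 = m := by ring
    refine recurrence_eq_zero_of_maximizer (b := krawtchoukJacobi n) (m := m)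
      (fun i hi => krawtchoukJacobi_pos (by omega)) (krawtchoukOrthonormal_zero _ _) ?_ ?_
      hle hy.symm hy1
    · rw [krawtchoukOrthonormal_one hn, hx]
    · intro j hj
      rw [krawtchoukOrthonormal_add_two (by omega), hx]
  · intro x hx
    rw [Set.mem_ofPred_eq, ← krawtchoukOrthonormal_eq_zero_iff hk] at hx
    have h := jacobiForm_of_recurrence (b := krawtchoukJacobi n) (k := k)
      (krawtchoukOrthonormal_one hn x) fun j hj => krawtchoukOrthonormal_add_two (by omega) x
    have hpos : 0 < ∑ i ∈ range (k + 1), (krawtchoukOrthonormal n x i) ^ 2 := by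
      refine sum_pos' (fun _ _ => sq_nonneg _) ⟨0, by simp, ?_⟩
      simp [krawtchoukOrthonormal_zero]
    have hl := hle (krawtchoukOrthonormal n x)
    rw [hx, mul_zero, add_zero] at h
    have : x - n / 2 ≤ m := le_of_mul_le_mul_right (by linarith) hpos
    linarith
end
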